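/- arXiv:1003.4229 — 12 statements merged into one kernel-verified Lean document; each statement's English description precedes it below -/
import Mathlib

section
/- Let R be a commutative ring with unit and let A be a nontrivial ℤ^r-graded R-algebra such that ff' ≠ 0 for any two non-zero homogeneous elements f, f' ∈ A. If g, g' ∈ A are non-zero and the product gg' is homogeneous, then both g and g' are homogeneous. -/
open DirectSum

section GradedRing

variable {ι A σ : Type*} [DecidableEq ι] [AddMonoid ι] [Semiring A] [SetLike σ A]
  [AddSubmonoidClass σ A] (𝒜 : ι → σ) [GradedRing 𝒜] [∀ (i) (x : 𝒜 i), Decidable (x ≠ 0)]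

theorem coe_decompose_mul_of_uniqueAdd {a b : A} {i j : ι}
    (hi : i ∈ (decompose 𝒜 a).support) (hj : j ∈ (decompose 𝒜 b).support)
    (hu : UniqueAdd (decompose 𝒜 a).support (decompose 𝒜 b).support i j) :
    (decompose 𝒜 (a * b) (i + j) : A) = decompose 𝒜 a i * decompose 𝒜 b j := by
  rw [decompose_mul, coe_mul_apply]
  refine Finset.sum_eq_single_of_mem (i, j) (by simp_all) fun p hp hne ↦ ?_
  rw [Finset.mem_filter, Finset.mem_product] at hp
  exact absurd (Prod.ext_iff.2 (hu hp.1.1 hp.1.2 hp.2)) hne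

theorem exists_mem_of_card_support_decompose_eq_one {a : A}
    (ha : (decompose 𝒜 a).support.card = 1) : ∃ i, a ∈ 𝒜 i := by
  obtain ⟨i, hi⟩ := Finset.card_eq_one.1 ha
  refine ⟨i, ?_⟩
  rw [← sum_support_decompose 𝒜 a, hi, Finset.sum_singleton]
  exact SetLike.coe_mem _

theorem card_support_decompose_mul_card_support_decompose_eq_one [TwoUniqueSums ι]
    (h : ∀ ⦃i j : ι⦄ ⦃a b : A⦄, a ∈ 𝒜 i → b ∈ 𝒜 j → a ≠ 0 → b ≠ 0 → a * b ≠ 0)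
    {a b : A} (ha : a ≠ 0) (hb : b ≠ 0) {w : ι} (hab : a * b ∈ 𝒜 w) :
    (decompose 𝒜 a).support.card * (decompose 𝒜 b).support.card = 1 := by
  have pos {x : A} (hx : x ≠ 0) : 0 < (decompose 𝒜 x).support.card := by
    rw [Finset.card_pos, Finset.nonempty_iff_ne_empty]
    intro h0
    apply hx
    rw [← sum_support_decompose 𝒜 x, h0, Finset.sum_empty]
  refine (Nat.succ_le_of_lt (Nat.mul_pos (pos ha) (pos hb))).antisymm' (not_lt.1 fun hlt ↦ ?_)
  have add_eq {i j : ι} (hi : i ∈ (decompose 𝒜 a).support) (hj : j ∈ (decompose 𝒜 b).support)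
      (hu : UniqueAdd (decompose 𝒜 a).support (decompose 𝒜 b).support i j) : w = i + j := by
    by_contra hw
    have hne := h (SetLike.coe_mem (decompose 𝒜 a i)) (SetLike.coe_mem (decompose 𝒜 b j))
      (by simpa using hi) (by simpa using hj)
    rw [← coe_decompose_mul_of_uniqueAdd 𝒜 hi hj hu] at hne
    exact hne (decompose_of_mem_ne 𝒜 hab hw)
  obtain ⟨p, hp, q, hq, hpq, hup, huq⟩ := TwoUniqueSums.uniqueAdd_of_one_lt_card hlt
  rw [Finset.mem_product] at hp hq
  exact hpq (Prod.ext_iff.2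
    (huq hp.1 hp.2 ((add_eq hp.1 hp.2 hup).symm.trans (add_eq hq.1 hq.2 huq))))

end GradedRing


/-- If `A` is a nontrivial `ℤ^r`-graded `R`-algebra such that the product of any two
non-zero homogeneous elements is non-zero, and `g, g'` are non-zero elements whose
product is homogeneous, then `g` and `g'` are homogeneous. -/
theorem statement1 {R A : Type*} [CommRing R] [CommRing A] [Algebra R A] [Nontrivial A]
    {r : ℕ} (𝒜 : (Fin r → ℤ) → Submodule R A) [GradedAlgebra 𝒜]
    (h : ∀ f f' : A, f ≠ 0 → f' ≠ 0 → (∃ w, f ∈ 𝒜 w) → (∃ w', f' ∈ 𝒜 w') →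
      f * f' ≠ 0)
    (g g' : A) (hg : g ≠ 0) (hg' : g' ≠ 0) (hgg' : ∃ w, g * g' ∈ 𝒜 w) :
    (∃ w, g ∈ 𝒜 w) ∧ (∃ w, g' ∈ 𝒜 w) := by
  classical
  obtain ⟨w, hw⟩ := hgg'
  have hcard := mul_eq_one.1 <| card_support_decompose_mul_card_support_decompose_eq_one 𝒜
    (fun i j a b ha hb ha0 hb0 ↦ h a b ha0 hb0 ⟨i, ha⟩ ⟨j, hb⟩) hg hg' hw
  exact ⟨exists_mem_of_card_support_decompose_eq_one 𝒜 hcard.1,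
    exists_mem_of_card_support_decompose_eq_one 𝒜 hcard.2⟩
end

section
/- Let K be an abelian monoid admitting cancellation and let L, M ⊆ K be finitely generated submonoids. Then the intersection L ∩ M is a finitely generated submonoid of K. -/
/-- A finitely generated submonoid of an additive commutative monoid is the range of a homomorphism
from a free commutative monoid on finitely many generators. -/
theorem AddSubmonoid.FG.exists_finsupp_mrange_eq {K : Type*} [AddCommMonoid K]
    {L : AddSubmonoid K} (hL : L.FG) :
    ∃ (s : Finset K) (f : (s →₀ ℕ) →+ K), AddMonoidHom.mrange f = L := by
  obtain ⟨s, rfl⟩ := hL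
  refine ⟨s, (Finsupp.linearCombination ℕ ((↑) : s → K)).toAddMonoidHom, ?_⟩
  ext x
  rw [← Submodule.span_nat_eq_addSubmonoidClosure, Submodule.mem_toAddSubmonoid,
    Finsupp.mem_span_iff_linearCombination]
  rfl

/-- In a cancellative abelian monoid, the intersection of two finitely generated
submonoids is finitely generated. -/
theorem statement3 {K : Type*} [AddCancelCommMonoid K] (L M : AddSubmonoid K)
    (hL : L.FG) (hM : M.FG) : (L ⊓ M).FG := by
  obtain ⟨s, f, rfl⟩ := hL.exists_finsupp_mrange_eq
  obtain ⟨t, g, rfl⟩ := hM.exists_finsupp_mrange_eq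
  let F : (s →₀ ℕ) × (t →₀ ℕ) →+ K := f.comp (AddMonoidHom.fst _ _)
  let G : (s →₀ ℕ) × (t →₀ ℕ) →+ K := g.comp (AddMonoidHom.snd _ _)
  have h : AddMonoidHom.mrange f ⊓ AddMonoidHom.mrange g = (F.eqLocusM G).map F := by
    ext x
    constructor
    · rintro ⟨⟨a, rfl⟩, ⟨b, hb⟩⟩
      exact ⟨(a, b), hb.symm, rfl⟩
    · rintro ⟨⟨a, b⟩, hab, rfl⟩
      exact ⟨⟨a, rfl⟩, ⟨b, Eq.symm hab⟩⟩
  rw [h]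
  exact (AddSubmonoid.fg_eqLocusM F G).map F
end

section
/- Let R be a commutative ring with unit, let K be an abelian monoid admitting cancellation, let A be a K-graded R-algebra that is finitely generated as an R-algebra, and let L ⊆ K be a finitely generated submonoid. Then the Veronese subalgebra A(L) = ⊕_{w∈L} A_w is a finitely generated R-algebra. -/
/-- The preimage of a finitely generated submonoid under a homomorphism from a free commutative
monoid of finite rank to a cancellative commutative monoid is finitely generated. -/
theorem AddSubmonoid.FG.comap_of_pi_nat {ι K : Type*} [Finite ι] [AddCancelCommMonoid K]
    {L : AddSubmonoid K} (hL : L.FG) (f : (ι → ℕ) →+ K) : (L.comap f).FG := by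
  obtain ⟨s, rfl⟩ := hL
  let g : (s → ℕ) →+ K :=
    { toFun := fun n => ∑ x, n x • (x : K)
      map_zero' := by simp
      map_add' := fun a b => by simp [add_smul, Finset.sum_add_distrib] }
  have hg (x : K) : x ∈ AddSubmonoid.closure (s : Set K) ↔ ∃ n, g n = x := by
    have h := AddSubmonoid.mem_closure_range_iff_of_fintype (f := ((↑) : s → K)) (x := x)
    rw [Subtype.range_coe] at h
    simpa [g, eq_comm] using h
  have key : (AddSubmonoid.closure (s : Set K)).comap f =
      ((f.comp (AddMonoidHom.fst (ι → ℕ) (s → ℕ))).eqLocusM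
        (g.comp (AddMonoidHom.snd (ι → ℕ) (s → ℕ)))).map (AddMonoidHom.fst _ _) := by
    ext n
    simp only [AddSubmonoid.mem_comap, hg, AddSubmonoid.mem_map, Prod.exists]
    constructor
    · rintro ⟨k, hk⟩
      exact ⟨n, k, hk.symm, rfl⟩
    · rintro ⟨_, k, hk, rfl⟩
      exact ⟨k, hk.symm⟩
  rw [key]
  exact (AddSubmonoid.fg_eqLocusM _ _).map _

/-- A graded algebra of finite type is generated by finitely many homogeneous elements. -/
theorem GradedAlgebra.exists_finset_homogeneous_adjoin_eq_top {R A K : Type*} [CommRing R]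
    [CommRing A] [Algebra R A] [AddMonoid K] [DecidableEq K]
    (𝒜 : K → Submodule R A) [GradedAlgebra 𝒜] [hA : Algebra.FiniteType R A] :
    ∃ G : Finset (K × A), (∀ p ∈ G, p.2 ∈ 𝒜 p.1) ∧
      Algebra.adjoin R (Prod.snd '' (G : Set (K × A))) = ⊤ := by
  classical
  obtain ⟨T, hT⟩ := hA.out
  refine ⟨T.biUnion fun t => (DirectSum.decompose 𝒜 t).support.image
    fun w => (w, (DirectSum.decompose 𝒜 t w : A)), ?_, ?_⟩
  · simp only [Finset.mem_biUnion, Finset.mem_image]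
    rintro _ ⟨t, -, w, -, rfl⟩
    exact SetLike.coe_mem _
  · rw [eq_top_iff, ← hT, Algebra.adjoin_le_iff]
    intro t ht
    rw [← DirectSum.sum_support_decompose 𝒜 t]
    refine sum_mem fun w hw => Algebra.subset_adjoin ⟨(w, _), ?_, rfl⟩
    exact Finset.mem_biUnion.2 ⟨t, ht, Finset.mem_image_of_mem _ hw⟩

/-- A commutative algebra is spanned by the monomials in a finite family of generators. -/
theorem Algebra.span_range_prod_pow_eq_top {R A ι : Type*} [CommRing R] [CommRing A] [Algebra R A]
    [Fintype ι] {a : ι → A} (ha : Algebra.adjoin R (Set.range a) = ⊤) :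
    Submodule.span R (Set.range fun n : ι → ℕ => ∏ i, a i ^ n i) = ⊤ := by
  rw [← Algebra.top_toSubmodule, ← ha, Algebra.adjoin_eq_span]
  congr 1
  ext x
  simp [Submonoid.mem_closure_range_iff_of_fintype, eq_comm]


/-- If `A` is a finitely generated `K`-graded `R`-algebra, where `K` is a cancellative
abelian monoid, and `L ⊆ K` is a finitely generated submonoid, then the Veronese
subalgebra `A(L) = ⊕_{w ∈ L} A_w` is a finitely generated `R`-algebra. -/
theorem statement6 {R A K : Type*} [CommRing R] [CommRing A] [Algebra R A]
    [AddCancelCommMonoid K] [DecidableEq K]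
    (𝒜 : K → Submodule R A) [GradedAlgebra 𝒜]
    [Algebra.FiniteType R A]
    (L : AddSubmonoid K) (hLfg : L.FG)
    (S : Subalgebra R A)
    (hS : Subalgebra.toSubmodule S = ⨆ w ∈ L, 𝒜 w) :
    Algebra.FiniteType R S := by
  obtain ⟨G, hG, hGtop⟩ := GradedAlgebra.exists_finset_homogeneous_adjoin_eq_top (R := R) 𝒜
  let f : (G → ℕ) →+ K :=
    { toFun := fun n => ∑ g, n g • g.1.1
      map_zero' := by simp
      map_add' := fun a b => by simp [add_smul, Finset.sum_add_distrib] }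
  let m : (G → ℕ) → A := fun n => ∏ g, g.1.2 ^ n g
  have hm (n : G → ℕ) : m n ∈ 𝒜 (f n) :=
    SetLike.prod_pow_mem_graded 𝒜 _ _ n fun g _ => hG g.1 g.2
  have hspan : Submodule.span R (Set.range m) = ⊤ := by
    refine Algebra.span_range_prod_pow_eq_top ?_
    rw [← hGtop]
    congr 1
    ext x
    simp
  obtain ⟨F, hF⟩ := hLfg.comap_of_pi_nat f
  have hmem {n : G → ℕ} (hn : f n ∈ L) : m n ∈ Algebra.adjoin R (m '' F) := by
    have hn' : n ∈ AddSubmonoid.closure (F : Set (G → ℕ)) := hF ▸ hn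
    clear hn
    induction hn' using AddSubmonoid.closure_induction with
    | mem x hx => exact Algebra.subset_adjoin ⟨x, hx, rfl⟩
    | zero => simp [m]
    | add x y _ _ hx hy =>
      have : m (x + y) = m x * m y := by simp [m, pow_add, Finset.prod_mul_distrib]
      exact this ▸ mul_mem hx hy
  have hproj {w : K} (hw : w ∈ L) (a : A) :
      GradedAlgebra.proj 𝒜 w a ∈ Algebra.adjoin R (m '' F) := by
    have ha : a ∈ Submodule.span R (Set.range m) := hspan ▸ Submodule.mem_top
    induction ha using Submodule.span_induction with
    | mem x hx =>
      obtain ⟨n, rfl⟩ := hx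
      rw [GradedAlgebra.proj_apply]
      by_cases h : f n = w
      · subst h
        rw [DirectSum.decompose_of_mem_same 𝒜 (hm n)]
        exact hmem hw
      · rw [DirectSum.decompose_of_mem_ne 𝒜 (hm n) h]
        exact zero_mem _
    | zero => simp
    | add x y _ _ hx hy => rw [map_add]; exact add_mem hx hy
    | smul r x _ hx => rw [map_smul]; exact Subalgebra.smul_mem _ hx r
  rw [← Subalgebra.fg_iff_finiteType]
  refine Subalgebra.fg_def.2 ⟨m '' F, F.finite_toSet.image m, le_antisymm ?_ ?_⟩
  · rw [Algebra.adjoin_le_iff]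
    rintro _ ⟨n, hn, rfl⟩
    have hnL : f n ∈ L := by
      have : n ∈ L.comap f := hF ▸ AddSubmonoid.subset_closure hn
      exact this
    rw [SetLike.mem_coe, ← Subalgebra.mem_toSubmodule, hS]
    exact Submodule.mem_iSup_of_mem _ (Submodule.mem_iSup_of_mem hnL (hm n))
  · rw [← OrderEmbedding.le_iff_le Subalgebra.toSubmodule, hS]
    refine iSup₂_le fun w hw a ha => ?_
    have h := hproj hw a
    rwa [GradedAlgebra.proj_apply, DirectSum.decompose_of_mem_same 𝒜 ha] at h
end

section
/- Let R be a noetherian commutative ring with unit, K a finitely generated abelian group, A an integral K-graded R-algebra, and L ⊆ K a submonoid such that for every w in the weight monoid S(A) there exists an integer n ≥ 1 with nw ∈ L. If the Veronese subalgebra A(L) is finitely generated over R, then A is finitely generated over R. -/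
/-- For a finite subset `T` of a finitely generated abelian group, the elements `w` having a
positive multiple of the form `∑ r t • t` with coefficients `r t` bounded by that multiple
form a finite set. -/
theorem finite_setOf_nsmul_eq_sum {K : Type*} [AddCommGroup K] [AddGroup.FG K] (T : Finset K) :
    {w : K | ∃ n : ℕ, 0 < n ∧ ∃ r : K → ℕ, (∀ t, r t < n) ∧
      n • w = ∑ t ∈ T, r t • t}.Finite := by
  obtain ⟨d, ι, _, p, hp, e, ⟨φ⟩⟩ := AddCommGroup.equiv_free_prod_directSum_zmod K
  have : ∀ i, NeZero (p i ^ e i) := fun i => ⟨pow_ne_zero _ (hp i).ne_zero⟩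
  classical
  have : Finite (DirectSum ι fun i => ZMod (p i ^ e i)) :=
    Finite.of_equiv _ (DirectSum.addEquivProd _).symm.toEquiv
  let c : Fin d → ℤ := fun j => ∑ t ∈ T, |(φ t).1 j|
  have hbox : ((fun v : Fin d →₀ ℤ => (v : Fin d → ℤ)) ⁻¹' Set.Icc (-c) c).Finite :=
    (Set.finite_Icc _ _).preimage DFunLike.coe_injective.injOn
  refine ((hbox.prod Set.finite_univ).preimage φ.injective.injOn).subset ?_
  rintro w ⟨n, hn, r, hr, hw⟩
  have key : ∀ j, |(φ w).1 j| ≤ c j := by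
    intro j
    let ψ : K →+ ℤ :=
      (Finsupp.applyAddHom j).comp ((AddMonoidHom.fst _ _).comp φ.toAddMonoidHom)
    have h1 : (n : ℤ) * ψ w = ∑ t ∈ T, (r t : ℤ) * ψ t := by
      simpa using congrArg ψ hw
    have hn' : (0 : ℤ) < n := by exact_mod_cast hn
    refine le_of_mul_le_mul_left ?_ hn'
    calc (n : ℤ) * |ψ w| = |∑ t ∈ T, (r t : ℤ) * ψ t| := by
          rw [← h1, abs_mul, abs_of_pos hn']
      _ ≤ ∑ t ∈ T, |(r t : ℤ) * ψ t| := Finset.abs_sum_le_sum_abs _ _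
      _ ≤ ∑ t ∈ T, (n : ℤ) * |ψ t| := by
          refine Finset.sum_le_sum fun t _ => ?_
          rw [abs_mul, Nat.abs_cast]
          exact mul_le_mul_of_nonneg_right (by exact_mod_cast (hr t).le) (abs_nonneg _)
      _ = n * ∑ t ∈ T, |ψ t| := by rw [Finset.mul_sum]
  refine ⟨⟨fun j => (abs_le.1 (key j)).1, fun j => (abs_le.1 (key j)).2⟩, trivial⟩

/-- The saturation of a finitely generated submonoid `P` of a finitely generated abelian group
is contained in finitely many translates of `P`. -/
theorem exists_finite_translates_of_nsmul_mem {K : Type*} [AddCommGroup K] [AddGroup.FG K]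
    {P : AddSubmonoid K} (hP : P.FG) :
    ∃ B : Set K, B.Finite ∧ ∀ (w : K) (n : ℕ), 0 < n → n • w ∈ P →
      ∃ b ∈ B, ∃ q ∈ P, w = b + q := by
  obtain ⟨T, rfl⟩ := hP
  refine ⟨_, finite_setOf_nsmul_eq_sum T, fun w n hn hw => ?_⟩
  obtain ⟨f, -, hf⟩ := AddSubmonoid.mem_closure_finset.1 hw
  have hq : ∑ t ∈ T, (f t / n) • t ∈ AddSubmonoid.closure (T : Set K) :=
    sum_mem fun t ht => nsmul_mem (AddSubmonoid.subset_closure ht) _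
  refine ⟨w - ∑ t ∈ T, (f t / n) • t, ⟨n, hn, fun t => f t % n, fun t => Nat.mod_lt _ hn, ?_⟩,
    _, hq, by abel⟩
  rw [nsmul_sub, ← hf, sub_eq_iff_eq_add, Finset.smul_sum, ← Finset.sum_add_distrib]
  refine Finset.sum_congr rfl fun t _ => ?_
  rw [smul_smul, ← add_smul, Nat.mod_add_div]

section Graded

variable {R A K : Type*} [CommRing R] [CommRing A] [Algebra R A] [AddCommGroup K] [DecidableEq K]
  (𝒜 : K → Submodule R A) [GradedAlgebra 𝒜]

theorem biSup_mul_biSup_le {X Y Z : Set K} (h : ∀ x ∈ X, ∀ y ∈ Y, x + y ∈ Z) :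
    (⨆ w ∈ X, 𝒜 w) * (⨆ w ∈ Y, 𝒜 w) ≤ ⨆ w ∈ Z, 𝒜 w := by
  simp only [Submodule.iSup_mul, Submodule.mul_iSup, iSup_le_iff]
  intro x hx y hy
  exact (Submodule.mul_le.2 fun a ha b hb => SetLike.mul_mem_graded ha hb).trans
    (le_biSup 𝒜 (h _ ‹_› _ ‹_›))

theorem mem_of_mem_biSup {X : Set K} {x : A} (hx : x ∈ ⨆ w ∈ X, 𝒜 w) {w : K}
    (hw : (DirectSum.decompose 𝒜 x w : A) ≠ 0) : w ∈ X := by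
  by_contra hwX
  refine hw ?_
  induction hx using Submodule.iSup_induction' with
  | mem v y hy =>
    by_cases hv : v ∈ X
    · rw [iSup_pos hv] at hy
      exact DirectSum.decompose_of_mem_ne 𝒜 hy fun h => hwX (h ▸ hv)
    · rw [iSup_neg hv, Submodule.mem_bot] at hy
      simp [hy]
  | zero => simp
  | add x y _ _ hx hy => simp_all

theorem mem_biSup_of_forall {X : Set K} {x : A}
    (h : ∀ w, (DirectSum.decompose 𝒜 x w : A) ≠ 0 → w ∈ X) : x ∈ ⨆ w ∈ X, 𝒜 w := by
  classical
  rw [← DirectSum.sum_support_decompose 𝒜 x]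
  refine sum_mem fun w hw => ?_
  have : (DirectSum.decompose 𝒜 x w : A) ≠ 0 := by
    simpa using hw
  exact Submodule.mem_iSup_of_mem w (Submodule.mem_iSup_of_mem (h w this) (SetLike.coe_mem _))

/-- The submonoid of weights of an integral graded algebra. -/
def weightMonoid [IsDomain A] : AddSubmonoid K where
  carrier := {w | 𝒜 w ≠ ⊥}
  zero_mem' := (Submodule.ne_bot_iff _).2 ⟨1, SetLike.one_mem_graded 𝒜, one_ne_zero⟩
  add_mem' := by
    intro v w hv hw
    obtain ⟨x, hx, hx0⟩ := (Submodule.ne_bot_iff _).1 hv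
    obtain ⟨y, hy, hy0⟩ := (Submodule.ne_bot_iff _).1 hw
    exact (Submodule.ne_bot_iff _).2 ⟨x * y, SetLike.mul_mem_graded hx hy, mul_ne_zero hx0 hy0⟩

/-- A finitely generated Veronese subalgebra is the Veronese subalgebra of a finitely generated
monoid of weights. -/
theorem exists_fg_weights [IsDomain A] (L : AddSubmonoid K) (S : Subalgebra R A)
    (hS : Subalgebra.toSubmodule S = ⨆ w ∈ L, 𝒜 w) (hSfg : S.FG) :
    ∃ P : AddSubmonoid K, P.FG ∧ P ≤ weightMonoid 𝒜 ∧ L ⊓ weightMonoid 𝒜 ≤ P ∧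
      Subalgebra.toSubmodule S = ⨆ w ∈ P, 𝒜 w := by
  classical
  obtain ⟨T, hT⟩ := hSfg
  let W : Finset K := T.biUnion fun t => (DirectSum.decompose 𝒜 t).support
  have hW : ∀ w, w ∈ W ↔ ∃ t ∈ T, (DirectSum.decompose 𝒜 t w : A) ≠ 0 := by
    intro w; simp [W]
  have hTS : ∀ t ∈ T, t ∈ ⨆ w ∈ L, 𝒜 w := by
    intro t ht
    rw [← hS, Subalgebra.mem_toSubmodule, ← hT]
    exact Algebra.subset_adjoin ht
  set P := AddSubmonoid.closure (W : Set K) with hPdef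
  have hWP : ∀ w ∈ W, w ∈ P := fun w hw => AddSubmonoid.subset_closure hw
  have hPL : P ≤ L := by
    refine (AddSubmonoid.closure_le).2 fun w hw => ?_
    obtain ⟨t, ht, hne⟩ := (hW w).1 hw
    exact mem_of_mem_biSup 𝒜 (X := (L : Set K)) (hTS t ht) hne
  let S' : Subalgebra R A := Submodule.toSubalgebra (⨆ w ∈ (P : Set K), 𝒜 w)
    (Submodule.mem_iSup_of_mem 0 (Submodule.mem_iSup_of_mem P.zero_mem
      (SetLike.one_mem_graded 𝒜)))
    (fun x y hx hy => biSup_mul_biSup_le 𝒜 (fun _ ha _ hb => P.add_mem ha hb)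
      (Submodule.mul_mem_mul hx hy))
  have hSS' : S ≤ S' := by
    rw [← hT]
    refine Algebra.adjoin_le fun t ht => ?_
    exact mem_biSup_of_forall 𝒜 fun w hw => hWP w ((hW w).2 ⟨t, ht, hw⟩)
  refine ⟨P, ⟨W, rfl⟩, ?_, ?_, ?_⟩
  · refine (AddSubmonoid.closure_le).2 fun w hw => ?_
    obtain ⟨t, ht, hne⟩ := (hW w).1 hw
    exact (Submodule.ne_bot_iff _).2 ⟨_, SetLike.coe_mem _, hne⟩
  · rintro w ⟨hwL, hw⟩
    obtain ⟨x, hx, hx0⟩ := (Submodule.ne_bot_iff _).1 hw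
    have hxS : x ∈ S := by
      rw [← Subalgebra.mem_toSubmodule, hS]
      exact Submodule.mem_iSup_of_mem w (Submodule.mem_iSup_of_mem hwL hx)
    refine mem_of_mem_biSup 𝒜 (X := (P : Set K)) (hSS' hxS) (w := w) ?_
    rwa [DirectSum.decompose_of_mem_same 𝒜 hx]
  · refine le_antisymm hSS' ?_
    rw [hS]
    exact biSup_mono hPL

/-- A translate `b + P` of a monoid `P` defines a submodule over the Veronese subalgebra of `P`. -/
def translateSubmodule (P : AddSubmonoid K) (S : Subalgebra R A)
    (hS : Subalgebra.toSubmodule S = ⨆ w ∈ P, 𝒜 w) (b : K) : Submodule S A where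
  __ := (⨆ w ∈ {w | ∃ q ∈ P, w = b + q}, 𝒜 w : Submodule R A).toAddSubmonoid
  smul_mem' := by
    intro s x hx
    have hs : (s : A) ∈ ⨆ w ∈ (P : Set K), 𝒜 w := hS ▸ (Subalgebra.mem_toSubmodule S).2 s.2
    refine biSup_mul_biSup_le 𝒜 ?_ (Submodule.mul_mem_mul hs hx)
    rintro p hp _ ⟨q, hq, rfl⟩
    exact ⟨p + q, P.add_mem hp hq, by abel⟩

theorem translateSubmodule_fg [IsDomain A] (P : AddSubmonoid K) (S : Subalgebra R A)
    (hS : Subalgebra.toSubmodule S = ⨆ w ∈ P, 𝒜 w) [IsNoetherianRing S] (b m : K)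
    (hm : m ∈ weightMonoid 𝒜) (hmb : m + b ∈ P) : (translateSubmodule 𝒜 P S hS b).FG := by
  obtain ⟨f, hf, hf0⟩ := (Submodule.ne_bot_iff _).1 hm
  refine Submodule.fg_of_fg_map_injective (LinearMap.mulLeft S f)
    (mul_right_injective₀ hf0) ?_
  have hle : (translateSubmodule 𝒜 P S hS b).map (LinearMap.mulLeft S f) ≤
      LinearMap.range (Algebra.linearMap S A) := by
    rintro _ ⟨x, hx, rfl⟩
    have hf' : f ∈ ⨆ w ∈ ({m} : Set K), 𝒜 w := by simpa using hf
    have : f * x ∈ ⨆ w ∈ (P : Set K), 𝒜 w := by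
      refine biSup_mul_biSup_le 𝒜 ?_ (Submodule.mul_mem_mul hf' hx)
      rintro _ rfl _ ⟨q, hq, rfl⟩
      rw [← add_assoc]
      exact P.add_mem hmb hq
    exact ⟨⟨f * x, (Subalgebra.mem_toSubmodule S).1 (hS ▸ this)⟩, rfl⟩
  have hN : IsNoetherian S (LinearMap.range (Algebra.linearMap S A)) := inferInstance
  exact (isNoetherian_submodule.1 hN) _ hle

end Graded


/-- Let `R` be noetherian, `K` a finitely generated abelian group, `A` an integral
`K`-graded `R`-algebra, and `L ⊆ K` a submonoid such that every weight `w` of `A` has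
a positive multiple `n • w ∈ L`.  If the Veronese subalgebra `A(L) = ⊕_{w ∈ L} A_w`
is finitely generated over `R`, then so is `A`. -/
theorem statement7 {R A K : Type*} [CommRing R] [IsNoetherianRing R]
    [CommRing A] [Algebra R A] [IsDomain A]
    [AddCommGroup K] [DecidableEq K] [AddGroup.FG K]
    (𝒜 : K → Submodule R A) [GradedAlgebra 𝒜]
    (L : AddSubmonoid K)
    (hL : ∀ w : K, 𝒜 w ≠ ⊥ → ∃ n : ℕ, 0 < n ∧ n • w ∈ L)
    (S : Subalgebra R A)
    (hS : Subalgebra.toSubmodule S = ⨆ w ∈ L, 𝒜 w)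
    (hSfg : Algebra.FiniteType R S) :
    Algebra.FiniteType R A := by
  have : IsNoetherianRing S := Algebra.FiniteType.isNoetherianRing R S
  obtain ⟨P, hPfg, hPM, hLP, hSP⟩ :=
    exists_fg_weights 𝒜 L S hS (Subalgebra.fg_iff_finiteType S |>.2 hSfg)
  obtain ⟨B, hB, hcov⟩ := exists_finite_translates_of_nsmul_mem hPfg
  have hmul : ∀ w ∈ weightMonoid 𝒜, ∃ n : ℕ, 0 < n ∧ n • w ∈ P := fun w hw =>
    let ⟨n, hn, hnw⟩ := hL w hw
    ⟨n, hn, hLP ⟨hnw, nsmul_mem hw n⟩⟩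
  let B' : Set K := {b ∈ B | ∃ w ∈ weightMonoid 𝒜, ∃ q ∈ P, w = b + q}
  have hB' : B'.Finite := hB.subset (Set.sep_subset _ _)
  have hfg : (⨆ b ∈ B', translateSubmodule 𝒜 P S hSP b).FG := by
    refine Submodule.fg_biSup hB'.toFinset _ ?_ |> fun h => by simpa using h
    intro b hb
    obtain ⟨-, w, hw, q, hq, rfl⟩ := hB'.mem_toFinset.1 hb
    obtain ⟨n, hn, hnw⟩ := hmul _ hw
    refine translateSubmodule_fg 𝒜 P S hSP b (q + (n - 1) • (b + q))
      (add_mem (hPM hq) (nsmul_mem hw _)) ?_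
    obtain ⟨k, rfl⟩ : ∃ k, n = k + 1 := ⟨n - 1, by omega⟩
    convert hnw using 1
    rw [Nat.add_sub_cancel, succ_nsmul]
    abel
  have htop : (⨆ b ∈ B', translateSubmodule 𝒜 P S hSP b) = ⊤ := by
    refine eq_top_iff.2 fun x _ => ?_
    classical
    rw [← DirectSum.sum_support_decompose 𝒜 x]
    refine sum_mem fun w hw => ?_
    have hw0 : (DirectSum.decompose 𝒜 x w : A) ≠ 0 := by simpa using hw
    have hwM : w ∈ weightMonoid 𝒜 :=
      (Submodule.ne_bot_iff _).2 ⟨_, SetLike.coe_mem _, hw0⟩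
    obtain ⟨n, hn, hnw⟩ := hmul w hwM
    obtain ⟨b, hb, q, hq, hwbq⟩ := hcov w n hn hnw
    refine Submodule.mem_iSup_of_mem b (Submodule.mem_iSup_of_mem ⟨hb, w, hwM, q, hq, hwbq⟩ ?_)
    exact Submodule.mem_iSup_of_mem (p := fun w => ⨆ _ : w ∈ {w | ∃ q ∈ P, w = b + q}, 𝒜 w) w
      (Submodule.mem_iSup_of_mem ⟨q, hq, hwbq⟩ (SetLike.coe_mem _))
  have : Module.Finite S A := ⟨htop ▸ hfg⟩
  exact Algebra.FiniteType.trans hSfg inferInstance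
end

section
/- Let R be a noetherian commutative ring with unit, K a finitely generated abelian group, A an integral K-graded R-algebra, and L ⊆ K a subgroup of finite index. Then A is finitely generated as an R-algebra if and only if the Veronese subalgebra A(L) is finitely generated as an R-algebra. -/
section Veronese

variable {R A K : Type*} [CommRing R] [CommRing A] [Algebra R A] [AddCommGroup K]
  [DecidableEq K] (𝒜 : K → Submodule R A) [GradedAlgebra 𝒜] (L : AddSubgroup K)
  (S : Subalgebra R A)

/-- If `S` contains all components of degree in a subgroup `L` of finite index, then `A` is
integral over `S`. -/
theorem Subalgebra.isIntegral_of_graded_finiteIndex [L.FiniteIndex]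
    (hS : ∀ w ∈ L, 𝒜 w ≤ Subalgebra.toSubmodule S) : Algebra.IsIntegral S A := by
  refine ⟨fun a ↦ ?_⟩
  classical
  rw [← DirectSum.sum_support_decompose 𝒜 a]
  refine IsIntegral.sum _ fun w _ ↦ ?_
  have hmem : (DirectSum.decompose 𝒜 a w : A) ^ L.index ∈ S :=
    hS _ (L.nsmul_index_mem w) (SetLike.pow_mem_graded _ (DirectSum.decompose 𝒜 a w).2)
  exact IsIntegral.of_pow (Nat.pos_of_ne_zero AddSubgroup.FiniteIndex.index_ne_zero)
    (isIntegral_algebraMap (x := (⟨_, hmem⟩ : S)))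

/-- The `S`-submodule of `A` generated by the components of degree in a coset of `L`. -/
def cosetComponent (c : K ⧸ L) : Submodule S A :=
  Submodule.span S {a | ∃ w : K, (w : K ⧸ L) = c ∧ a ∈ 𝒜 w}

theorem iSup_cosetComponent : ⨆ c, cosetComponent 𝒜 L S c = ⊤ := by
  refine eq_top_iff.2 fun a _ ↦ ?_
  classical
  rw [← DirectSum.sum_support_decompose 𝒜 a]
  exact Submodule.sum_mem _ fun w _ ↦ Submodule.mem_iSup_of_mem (w : K ⧸ L)
    (Submodule.subset_span ⟨w, rfl, (DirectSum.decompose 𝒜 a w).2⟩)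

theorem cosetComponent_fg [IsDomain A] [L.FiniteIndex] [IsNoetherianRing S]
    (hS : ∀ w ∈ L, 𝒜 w ≤ Subalgebra.toSubmodule S) (c : K ⧸ L) :
    (cosetComponent 𝒜 L S c).FG := by
  by_cases h : ∃ w : K, (w : K ⧸ L) = c ∧ ∃ f ∈ 𝒜 w, f ≠ 0
  · obtain ⟨w, rfl, f, hf, hf0⟩ := h
    have hg0 : f ^ (L.index - 1) ≠ 0 := pow_ne_zero _ hf0
    refine Submodule.fg_of_fg_map_injective (LinearMap.mulLeft S (f ^ (L.index - 1)))
      (mul_right_injective₀ hg0) ?_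
    have hle : (cosetComponent 𝒜 L S (w : K ⧸ L)).map
        (LinearMap.mulLeft S (f ^ (L.index - 1))) ≤ LinearMap.range (Algebra.linearMap S A) := by
      rw [cosetComponent, Submodule.map_span_le]
      rintro a ⟨v, hv, ha⟩
      have hdeg : (L.index - 1) • w + v ∈ L := by
        have hpos : L.index - 1 + 1 = L.index :=
          Nat.succ_pred_eq_of_ne_zero AddSubgroup.FiniteIndex.index_ne_zero
        have hsum : (L.index - 1) • w + v = L.index • w + (-w + v) := by
          conv_rhs => rw [← hpos, succ_nsmul]
          abel
        rw [hsum]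
        exact L.add_mem (L.nsmul_index_mem w) (QuotientAddGroup.eq.1 hv.symm)
      exact ⟨⟨_, hS _ hdeg (SetLike.mul_mem_graded (SetLike.pow_mem_graded _ hf) ha)⟩, rfl⟩
    have : IsNoetherian S (LinearMap.range (Algebra.linearMap S A)) := inferInstance
    exact isNoetherian_submodule.1 this _ hle
  · push Not at h
    have hbot : cosetComponent 𝒜 L S c = ⊥ :=
      Submodule.span_eq_bot.2 fun a ⟨w, hw, ha⟩ ↦ h w hw a ha
    exact hbot ▸ Submodule.fg_bot

end Veronese


/-- Let `R` be noetherian, `K` a finitely generated abelian group, `A` an integral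
`K`-graded `R`-algebra, and `L ⊆ K` a subgroup of finite index.  Then `A` is finitely
generated over `R` if and only if the Veronese subalgebra `A(L) = ⊕_{w ∈ L} A_w` is. -/
theorem statement8 {R A K : Type*} [CommRing R] [IsNoetherianRing R]
    [CommRing A] [Algebra R A] [IsDomain A]
    [AddCommGroup K] [DecidableEq K] [AddGroup.FG K]
    (𝒜 : K → Submodule R A) [GradedAlgebra 𝒜]
    (L : AddSubgroup K) [L.FiniteIndex]
    (S : Subalgebra R A)
    (hS : Subalgebra.toSubmodule S = ⨆ w ∈ L, 𝒜 w) :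
    Algebra.FiniteType R A ↔ Algebra.FiniteType R S := by
  have hle : ∀ w ∈ L, 𝒜 w ≤ Subalgebra.toSubmodule S := fun w hw ↦
    hS ▸ le_iSup₂_of_le w hw le_rfl
  constructor
  · intro h
    have := S.isIntegral_of_graded_finiteIndex 𝒜 L hle
    have : Algebra.FiniteType S A := .of_restrictScalars_finiteType R S A
    have : Module.Finite S A := Algebra.IsIntegral.finite
    exact ⟨fg_of_fg_of_fg R S A h.out Module.Finite.fg_top Subtype.val_injective⟩
  · intro h
    have : IsNoetherianRing S := Algebra.FiniteType.isNoetherianRing R S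
    have : Finite (K ⧸ L) := AddSubgroup.finite_quotient_of_finiteIndex
    have : Module.Finite S A :=
      ⟨iSup_cosetComponent 𝒜 L S ▸ Submodule.fg_iSup _ (cosetComponent_fg 𝒜 L S hle)⟩
    exact h.trans inferInstance
end

section
/- Let R be a noetherian commutative ring with unit, let L and K be abelian monoids admitting cancellation, let B be an L-graded R-algebra and A an integral K-graded R-algebra, and let F : L → K be a monoid homomorphism together with an R-algebra homomorphism φ : B → A satisfying φ(B_u) ⊆ A_{F(u)} for all u ∈ L. Assume that the weight monoid S(B) = {u ∈ L : B_u ≠ 0} is finitely generated and that φ restricts to an isomorphism B_u → A_{F(u)} of R-modules for every u ∈ L. Then finite generation of A as an R-algebra implies finite generation of B as an R-algebra. -/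
open DirectSum in
/-- A graded algebra of finite type is generated by a finite family of homogeneous elements. -/
theorem GradedAlgebra.exists_fintype_homogeneous_generators {R A K : Type*} [CommRing R]
    [CommRing A] [Algebra R A] [AddCommMonoid K] [DecidableEq K] (𝒜 : K → Submodule R A)
    [GradedAlgebra 𝒜] (hA : Algebra.FiniteType R A) :
    ∃ (s : Finset A) (w : s → K), (∀ i : s, (i : A) ∈ 𝒜 (w i)) ∧
      Algebra.adjoin R (s : Set A) = ⊤ := by
  classical
  obtain ⟨t, ht⟩ := hA.out
  let s : Finset A := t.biUnion fun x ↦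
    (decompose 𝒜 x).support.image fun k ↦ (decompose 𝒜 x k : A)
  have hs : ∀ i : s, ∃ k, (i : A) ∈ 𝒜 k := by
    rintro ⟨i, hi⟩
    obtain ⟨x, -, hx⟩ := Finset.mem_biUnion.1 hi
    obtain ⟨k, -, rfl⟩ := Finset.mem_image.1 hx
    exact ⟨k, (decompose 𝒜 x k).2⟩
  choose w hw using hs
  refine ⟨s, w, hw, ?_⟩
  rw [← top_le_iff, ← ht, Algebra.adjoin_le_iff]
  intro x hx
  rw [← sum_support_decompose 𝒜 x]
  exact sum_mem fun k hk ↦ Algebra.subset_adjoin <| Finset.mem_coe.2 <|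
    Finset.mem_biUnion.2 ⟨x, hx, Finset.mem_image_of_mem _ hk⟩

/-- If a graded algebra is generated by homogeneous elements, each homogeneous component is spanned
by the monomials in the generators of the corresponding degree. -/
theorem GradedAlgebra.mem_span_monomials {R A K ι : Type*} [CommRing R]
    [CommRing A] [Algebra R A] [AddCommMonoid K] [DecidableEq K] (𝒜 : K → Submodule R A)
    [GradedAlgebra 𝒜] [Fintype ι] {a : ι → A} {w : ι → K} (ha : ∀ i, a i ∈ 𝒜 (w i))
    (htop : Algebra.adjoin R (Set.range a) = ⊤) {k : K} {x : A} (hx : x ∈ 𝒜 k) :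
    x ∈ Submodule.span R {y | ∃ n : ι → ℕ, ∑ i, n i • w i = k ∧ ∏ i, a i ^ n i = y} := by
  rw [← DirectSum.decompose_of_mem_same 𝒜 hx]
  clear hx
  have hx : x ∈ Submodule.span R (Submonoid.closure (Set.range a) : Set A) := by
    rw [← Algebra.adjoin_eq_span, htop]
    trivial
  induction hx using Submodule.span_induction with
  | mem x hx =>
    obtain ⟨n, rfl⟩ := Submonoid.mem_closure_range_iff_of_fintype.1 hx
    have hn : ∏ i, a i ^ n i ∈ 𝒜 (∑ i, n i • w i) :=
      SetLike.prod_mem_graded _ _ _ fun i _ ↦ SetLike.pow_mem_graded _ (ha i)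
    by_cases hk : ∑ i, n i • w i = k
    · rw [← hk, DirectSum.decompose_of_mem_same 𝒜 hn]
      exact Submodule.subset_span ⟨n, rfl, rfl⟩
    · rw [DirectSum.decompose_of_mem_ne 𝒜 hn hk]
      exact zero_mem _
  | zero => simp
  | add x y _ _ hx hy => simpa using add_mem hx hy
  | smul r x _ hx =>
    rw [DirectSum.decompose_smul, DirectSum.smul_apply]
    exact Submodule.smul_mem _ r hx


/-- Let `R` be noetherian, `B` an `L`-graded `R`-algebra, `A` an integral `K`-graded
`R`-algebra (with `L, K` cancellative abelian monoids), and `(φ, F)` a morphism of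
graded algebras from `B` to `A` such that the weight monoid `S(B) = {u | B_u ≠ 0}` is
a finitely generated submonoid and `φ` restricts to an isomorphism `B_u → A_{F(u)}`
for every `u ∈ L`.  Then finite generation of `A` over `R` implies finite generation
of `B` over `R`. -/
theorem statement9 {R B A L K : Type*} [CommRing R] [IsNoetherianRing R]
    [CommRing B] [Algebra R B] [CommRing A] [Algebra R A] [IsDomain A]
    [AddCancelCommMonoid L] [DecidableEq L] [AddCancelCommMonoid K] [DecidableEq K]
    (ℬ : L → Submodule R B) [GradedAlgebra ℬ]
    (𝒜 : K → Submodule R A) [GradedAlgebra 𝒜]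
    (F : L →+ K) (φ : B →ₐ[R] A)
    (hmem : ∀ (u : L), ∀ b ∈ ℬ u, φ b ∈ 𝒜 (F u))
    (hfg : ∃ S : AddSubmonoid L, S.FG ∧ (S : Set L) = {u : L | ℬ u ≠ ⊥})
    (hinj : ∀ (u : L), ∀ b ∈ ℬ u, ∀ b' ∈ ℬ u, φ b = φ b' → b = b')
    (hsurj : ∀ (u : L), ∀ a ∈ 𝒜 (F u), ∃ b ∈ ℬ u, φ b = a)
    (hA : Algebra.FiniteType R A) :
    Algebra.FiniteType R B := by
  classical
  obtain ⟨s, w, hw, hs⟩ := GradedAlgebra.exists_fintype_homogeneous_generators 𝒜 hA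
  obtain ⟨S, ⟨t, rfl⟩, hS⟩ := hfg
  let mon (n : s → ℕ) : A := ∏ i : s, (i : A) ^ n i
  let degA : (s → ℕ) →+ K :=
    { toFun n := ∑ i, n i • w i
      map_zero' := by simp
      map_add' m n := by simp [add_smul, Finset.sum_add_distrib] }
  let degB : (t → ℕ) →+ L :=
    { toFun m := ∑ j, m j • (j : L)
      map_zero' := by simp
      map_add' m n := by simp [add_smul, Finset.sum_add_distrib] }
  have hmon (n : s → ℕ) : mon n ∈ 𝒜 (degA n) :=
    SetLike.prod_mem_graded _ _ _ fun i _ ↦ SetLike.pow_mem_graded _ (hw i)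
  let M : AddSubmonoid ((s → ℕ) × (t → ℕ)) :=
    (degA.comp (AddMonoidHom.fst _ _)).eqLocusM ((F.comp degB).comp (AddMonoidHom.snd _ _))
  obtain ⟨T, hT⟩ : M.FG := AddSubmonoid.fg_eqLocusM _ _
  have hlift : ∀ p ∈ M, ∃ b ∈ ℬ (degB p.2), φ b = mon p.1 := fun p hp ↦
    hsurj _ _ ((show degA p.1 = F (degB p.2) from hp) ▸ hmon p.1)
  choose! β hβ hφβ using hlift
  have hgen : ∀ p ∈ M, β p ∈ Algebra.adjoin R (T.image β : Set B) := by
    intro p hp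
    rw [← hT] at hp
    induction hp using AddSubmonoid.closure_induction with
    | mem p hp => exact Algebra.subset_adjoin (Finset.mem_coe.2 (Finset.mem_image_of_mem _ hp))
    | zero =>
      have h1 : β 0 = 1 := hinj 0 _ (by simpa using hβ 0 (zero_mem _)) _
        SetLike.GradedOne.one_mem (by simp [hφβ 0 (zero_mem _), mon])
      exact h1 ▸ one_mem _
    | add p q hp hq ihp ihq =>
      rw [hT] at hp hq
      have hmul : β (p + q) = β p * β q := by
        refine hinj _ _ (hβ _ (add_mem hp hq)) _ ?_ ?_
        · simpa using SetLike.GradedMul.mul_mem (hβ _ hp) (hβ _ hq)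
        · simp [hφβ _ (add_mem hp hq), hφβ _ hp, hφβ _ hq, mon, pow_add, Finset.prod_mul_distrib]
      exact hmul ▸ mul_mem ihp ihq
  have hhom : ∀ u, ∀ b ∈ ℬ u, b ∈ Algebra.adjoin R (T.image β : Set B) := by
    intro u b hb
    by_cases hu : ℬ u = ⊥
    · rw [hu, Submodule.mem_bot] at hb
      exact hb ▸ zero_mem _
    have hut : u ∈ AddSubmonoid.closure (t : Set L) := by
      rw [← SetLike.mem_coe, hS]
      exact hu
    obtain ⟨m, hm⟩ := AddSubmonoid.mem_closure_finset'.1 hut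
    replace hm : degB m = u := hm.symm
    have hspan := GradedAlgebra.mem_span_monomials 𝒜 (a := ((↑) : s → A)) hw
      (by simpa using hs) (hmem u b hb)
    have hle : Submodule.span R {y | ∃ n : s → ℕ, ∑ i, n i • w i = F u ∧ mon n = y} ≤
        (ℬ u ⊓ Subalgebra.toSubmodule (Algebra.adjoin R (T.image β : Set B))).map
          φ.toLinearMap := by
      rw [Submodule.span_le]
      rintro _ ⟨n, hn, rfl⟩
      have hp : (n, m) ∈ M := show degA n = F (degB m) by rw [hm]; exact hn
      exact ⟨β (n, m), ⟨hm ▸ hβ _ hp, hgen _ hp⟩, hφβ _ hp⟩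
    obtain ⟨b', ⟨hb', hadj⟩, hbb'⟩ := hle hspan
    exact hinj u b' hb' b hb hbb' ▸ hadj
  refine ⟨T.image β, ?_⟩
  rw [← top_le_iff]
  intro b _
  rw [← DirectSum.sum_support_decompose ℬ b]
  exact sum_mem fun u _ ↦ hhom u _ (DirectSum.decompose ℬ b u).2
end

section
/- Let L be a field of characteristic zero containing all roots of unity (for every m ≥ 1 there is a primitive m-th root of unity in L), and let a ∈ L be an element that is not a proper power, i.e., there are no b ∈ L and integer k ≥ 2 with a = b^k. Then for every integer n ≥ 1 the element 1 − a·t^n is irreducible in the Laurent polynomial ring L[t, t⁻¹]. -/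
open Polynomial in
/-- If a field contains a primitive `n`-th root of unity and `c` is not an `m`-th power for any
`m ≥ 2`, then `X ^ n - c` is irreducible. -/
theorem irreducible_X_pow_sub_C_of_isPrimitiveRoot {K : Type*} [Field K] {n : ℕ} (hn : 0 < n)
    {ζ : K} (hζ : IsPrimitiveRoot ζ n) {c : K}
    (hc : ∀ (b : K) (m : ℕ), 2 ≤ m → b ^ m ≠ c) : Irreducible (X ^ n - C c) := by
  have hc0 : c ≠ 0 := fun h ↦ hc 0 2 le_rfl (by simp [h])
  have hunit : ¬ IsUnit (X ^ n - C c) := by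
    rw [Polynomial.isUnit_iff_degree_eq_zero, degree_X_pow_sub_C hn, Nat.cast_eq_zero]
    exact hn.ne'
  obtain ⟨g, hg, hgdvd⟩ := WfDvdMonoid.exists_irreducible_factor hunit (X_pow_sub_C_ne_zero hn c)
  have hle : g.natDegree ≤ n :=
    (natDegree_le_of_dvd hgdvd (X_pow_sub_C_ne_zero hn c)).trans_eq natDegree_X_pow_sub_C
  suffices n ≤ g.natDegree from (associated_of_dvd_of_natDegree_le hgdvd
    (X_pow_sub_C_ne_zero hn c) (natDegree_X_pow_sub_C.trans_le this)).irreducible hg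
  by_contra! hlt
  have hpos : 0 < g.natDegree :=
    natDegree_pos_iff_degree_pos.mpr <| Polynomial.degree_pos_of_irreducible hg
  have key : (Algebra.norm K (AdjoinRoot.root g)) ^ n = c ^ g.natDegree := by
    have := eval₂_eq_zero_of_dvd_of_eval₂_eq_zero _ _ hgdvd (AdjoinRoot.eval₂_root g)
    rw [eval₂_sub, eval₂_pow, eval₂_C, eval₂_X, sub_eq_zero] at this
    rw [← map_pow, this, ← AdjoinRoot.algebraMap_eq, Algebra.norm_algebraMap,
      (AdjoinRoot.powerBasis hg.ne_zero).finrank, AdjoinRoot.powerBasis_dim hg.ne_zero]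
  obtain ⟨e, d, m, he, hcop, hd, hm⟩ := Nat.exists_coprime' (Nat.gcd_pos_of_pos_left n hpos)
  generalize Algebra.norm K (AdjoinRoot.root g) = N at key
  rw [hd, hm, pow_mul, pow_mul] at key
  have hm2 : 2 ≤ m := by
    have : d * e < m * e := by omega
    have := lt_of_mul_lt_mul_right this (Nat.zero_le _)
    have : 0 < d := Nat.pos_of_ne_zero (by rintro rfl; omega)
    omega
  have : NeZero e := ⟨he.ne'⟩
  have hprim : IsPrimitiveRoot (ζ ^ m) e := hζ.pow hn hm
  obtain ⟨i, -, hi⟩ := hprim.eq_pow_of_pow_eq_one (ξ := c ^ d / N ^ m) (by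
    rw [div_pow, ← key, div_self]
    rw [key]
    positivity)
  have hN : N ^ m ≠ 0 := fun h ↦ by
    rw [h, zero_pow he.ne'] at key
    exact (pow_ne_zero _ (pow_ne_zero _ hc0)) key.symm
  rw [eq_div_iff hN, ← pow_mul, mul_comm m i, pow_mul, ← mul_pow] at hi
  obtain ⟨b, hb⟩ := (pow_mem_range_pow_of_coprime hcop c).mp ⟨_, hi⟩
  exact hc b m hm2 hb

/-- A prime polynomial not dividing `X` stays prime in the Laurent polynomial ring. -/
theorem Polynomial.prime_toLaurent {K : Type*} [Field K] {p : Polynomial K} (hp : Prime p)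
    (hX : ¬ p ∣ Polynomial.X) : Prime (Polynomial.toLaurent p) := by
  rw [← Ideal.span_singleton_prime (Polynomial.toLaurent_ne_zero.mpr hp.ne_zero),
    ← LaurentPolynomial.algebraMap_eq_toLaurent, ← Set.image_singleton, ← Ideal.map_span]
  refine IsLocalization.isPrime_of_isPrime_disjoint
    (Submonoid.powers (Polynomial.X : Polynomial K)) _ _
    ((Ideal.span_singleton_prime hp.ne_zero).mpr hp) ?_
  rw [Set.disjoint_left]
  rintro _ ⟨k, rfl⟩ hk
  exact hX (hp.dvd_of_dvd_pow (Ideal.mem_span_singleton.mp hk))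

/-- Let `L` be a field of characteristic zero containing all roots of unity, and let
`a ∈ L` not be a proper power.  Then for every `n ≥ 1` the Laurent polynomial
`1 - a·tⁿ` is irreducible in `L[t, t⁻¹]`. -/
theorem statement12 {L : Type*} [Field L] [CharZero L]
    (hroots : ∀ m : ℕ, 0 < m → ∃ ζ : L, IsPrimitiveRoot ζ m)
    (a : L) (ha : ¬ ∃ (b : L) (k : ℕ), 2 ≤ k ∧ a = b ^ k)
    (n : ℕ) (hn : 1 ≤ n) :
    Irreducible (1 - LaurentPolynomial.C a * LaurentPolynomial.T (R := L) (n : ℤ)) := by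
  have ha0 : a ≠ 0 := fun h ↦ ha ⟨0, 2, le_rfl, by simp [h]⟩
  obtain ⟨ζ, hζ⟩ := hroots n hn
  have hirr : Irreducible (Polynomial.X ^ n - Polynomial.C a⁻¹) :=
    irreducible_X_pow_sub_C_of_isPrimitiveRoot hn hζ fun b m hm hb ↦
      ha ⟨b⁻¹, m, hm, by rw [inv_pow, hb, inv_inv]⟩
  have hX : ¬ (Polynomial.X ^ n - Polynomial.C a⁻¹) ∣ Polynomial.X := fun h ↦ by
    have h0 := (hirr.associated_of_dvd Polynomial.irreducible_X h).symm.dvd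
    rw [Polynomial.X_dvd_iff] at h0
    simp [Polynomial.coeff_X_pow, (Nat.one_le_iff_ne_zero.mp hn).symm, ha0] at h0
  have hprime := (Polynomial.prime_toLaurent hirr.prime hX).irreducible
  have hu : IsUnit (LaurentPolynomial.C (-a)) := (IsUnit.mk0 _ (neg_ne_zero.mpr ha0)).map _
  convert (irreducible_isUnit_mul hu).mpr hprime using 1
  rw [map_sub, Polynomial.toLaurent_X_pow, Polynomial.toLaurent_C, mul_sub, ← map_mul]
  simp [ha0]
  ring
end

section
/- Let 𝕂 be a field, K a finitely generated abelian group, and R an integral K-graded 𝕂-algebra whose units are exactly the non-zero constants, R^× = 𝕂^×. If R is factorially graded, then every K-prime ideal of K-height one in R is a principal ideal. -/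
variable {𝕂 K R : Type*} [Field 𝕂] [AddCommGroup K] [DecidableEq K]
  [CommRing R] [Algebra 𝕂 R]

/-- An element of a `K`-graded algebra is homogeneous if it lies in some graded piece. -/
def IsHomog (𝒜 : K → Submodule 𝕂 R) (f : R) : Prop :=
  ∃ w, f ∈ 𝒜 w

/-- A non-zero non-unit `f` is `K`-prime if it is homogeneous and whenever it divides a
product of homogeneous elements, it divides one of the factors. -/
def IsKPrime (𝒜 : K → Submodule 𝕂 R) (f : R) : Prop :=
  f ≠ 0 ∧ ¬ IsUnit f ∧ IsHomog 𝒜 f ∧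
    ∀ g h : R, IsHomog 𝒜 g → IsHomog 𝒜 h → f ∣ g * h → f ∣ g ∨ f ∣ h

/-- A `K`-graded algebra is factorially graded if every homogeneous non-zero non-unit
is a product of `K`-primes. -/
def FactoriallyGraded (𝒜 : K → Submodule 𝕂 R) : Prop :=
  ∀ f : R, f ≠ 0 → ¬ IsUnit f → IsHomog 𝒜 f →
    ∃ l : Multiset R, (∀ p ∈ l, IsKPrime 𝒜 p) ∧ l.prod = f

/-- An ideal is `K`-prime if it is generated by homogeneous elements and whenever a
product of two homogeneous elements lies in it, one of the factors does. -/
def IsKPrimeIdeal (𝒜 : K → Submodule 𝕂 R) (I : Ideal R) : Prop :=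
  (∃ S : Set R, (∀ s ∈ S, IsHomog 𝒜 s) ∧ I = Ideal.span S) ∧
    ∀ f g : R, IsHomog 𝒜 f → IsHomog 𝒜 g → f * g ∈ I → f ∈ I ∨ g ∈ I

/-- A `K`-prime ideal has `K`-height one if the maximal length of a chain of `K`-prime
ideals `𝔞₀ ⊂ … ⊂ 𝔞_d = I` is `d = 1`. -/
def HasKHeightOne (𝒜 : K → Submodule 𝕂 R) (I : Ideal R) : Prop :=
  (∃ J, IsKPrimeIdeal 𝒜 J ∧ J < I) ∧
    ¬ ∃ J₀ J₁ : Ideal R, IsKPrimeIdeal 𝒜 J₀ ∧ IsKPrimeIdeal 𝒜 J₁ ∧ J₀ < J₁ ∧ J₁ < I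

theorem IsHomog.multiset_prod (𝒜 : K → Submodule 𝕂 R) [SetLike.GradedMonoid 𝒜]
    (l : Multiset R) (hl : ∀ p ∈ l, IsHomog 𝒜 p) : IsHomog 𝒜 l.prod := by
  induction l using Multiset.induction_on with
  | empty => exact ⟨0, by simpa using SetLike.GradedOne.one_mem (A := 𝒜)⟩
  | cons a s ih =>
    obtain ⟨v, hv⟩ := hl a (Multiset.mem_cons_self a s)
    obtain ⟨w, hw⟩ := ih fun p hp => hl p (Multiset.mem_cons_of_mem hp)
    exact ⟨v + w, by simpa using SetLike.GradedMul.mul_mem hv hw⟩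

/-- A `K`-prime ideal containing a product of homogeneous elements is the whole ring or
contains one of the factors. -/
theorem IsKPrimeIdeal.exists_mem_of_multiset_prod_mem {𝒜 : K → Submodule 𝕂 R}
    [SetLike.GradedMonoid 𝒜] {I : Ideal R} (hI : IsKPrimeIdeal 𝒜 I) (htop : I ≠ ⊤)
    (l : Multiset R) (hl : ∀ p ∈ l, IsHomog 𝒜 p) (h : l.prod ∈ I) : ∃ p ∈ l, p ∈ I := by
  induction l using Multiset.induction_on with
  | empty => exact absurd ((Ideal.eq_top_iff_one I).2 (by simpa using h)) htop
  | cons a s ih =>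
    have hs : ∀ p ∈ s, IsHomog 𝒜 p := fun p hp => hl p (Multiset.mem_cons_of_mem hp)
    rw [Multiset.prod_cons] at h
    rcases hI.2 a s.prod (hl a (Multiset.mem_cons_self a s))
      (IsHomog.multiset_prod 𝒜 s hs) h with ha | ha
    · exact ⟨a, Multiset.mem_cons_self a s, ha⟩
    · obtain ⟨p, hp, hpI⟩ := ih hs ha
      exact ⟨p, Multiset.mem_cons_of_mem hp, hpI⟩

theorem isKPrimeIdeal_bot [IsDomain R] (𝒜 : K → Submodule 𝕂 R) :
    IsKPrimeIdeal 𝒜 (⊥ : Ideal R) := by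
  refine ⟨⟨∅, by simp, by simp⟩, fun f g _ _ h => ?_⟩
  simpa using h

theorem IsKPrime.isKPrimeIdeal_span {𝒜 : K → Submodule 𝕂 R} {p : R} (hp : IsKPrime 𝒜 p) :
    IsKPrimeIdeal 𝒜 (Ideal.span {p}) := by
  refine ⟨⟨{p}, by simpa using hp.2.2.1, rfl⟩, fun f g hf hg h => ?_⟩
  simp only [Ideal.mem_span_singleton] at h ⊢
  exact hp.2.2.2 f g hf hg h

/-- Let `R` be an integral `K`-graded algebra over a field `𝕂`, with `K` a finitely
generated abelian group, whose units are exactly the non-zero constants.  If `R` is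
factorially graded, then every `K`-prime ideal of `K`-height one is principal. -/
theorem statement13 [IsDomain R] [AddGroup.FG K]
    (𝒜 : K → Submodule 𝕂 R) [GradedAlgebra 𝒜]
    (hunits : ∀ x : R, IsUnit x ↔ ∃ c : 𝕂, c ≠ 0 ∧ algebraMap 𝕂 R c = x)
    (hfact : FactoriallyGraded 𝒜)
    (I : Ideal R) (hI : IsKPrimeIdeal 𝒜 I) (hht : HasKHeightOne 𝒜 I) :
    I.IsPrincipal := by
  by_cases htop : I = ⊤
  · exact htop ▸ inferInstance
  obtain ⟨⟨J, -, hJI⟩, hchain⟩ := hht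
  obtain ⟨S, hS, hIS⟩ := hI.1
  obtain ⟨f, hfS, hf0⟩ : ∃ f ∈ S, f ≠ 0 := by
    by_contra! h
    exact (bot_le.trans_lt hJI).ne' (hIS.trans (Ideal.span_eq_bot.2 h))
  have hfI : f ∈ I := hIS ▸ Ideal.subset_span hfS
  have hfu : ¬ IsUnit f := fun h => htop (Ideal.eq_top_of_isUnit_mem I hfI h)
  obtain ⟨l, hl, rfl⟩ := hfact f hf0 hfu (hS f hfS)
  obtain ⟨p, hpl, hpI⟩ :=
    hI.exists_mem_of_multiset_prod_mem htop l (fun p hp => (hl p hp).2.2.1) hfI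
  have hp := hl p hpl
  have hle : Ideal.span {p} ≤ I := (Ideal.span_singleton_le_iff_mem I).2 hpI
  have hbot : ⊥ < Ideal.span {p} :=
    bot_lt_iff_ne_bot.2 fun h => hp.1 (Ideal.span_singleton_eq_bot.1 h)
  have heq : Ideal.span {p} = I := by
    by_contra hne
    exact hchain ⟨⊥, Ideal.span {p}, isKPrimeIdeal_bot 𝒜, hp.isKPrimeIdeal_span, hbot,
      lt_of_le_of_ne hle hne⟩
  exact ⟨p, heq.symm⟩
end

section
/- Let 𝕂 be an algebraically closed field of characteristic zero and let R = 𝕂[T₁, T₂, T₃]/(T₁² − T₂T₃ − 1) be the coordinate ring of the smooth affine quadric surface Z = V(T₁² − T₂T₃ − 1) ⊆ 𝕂³. Then every unit of R is a non-zero constant, i.e., R^× is the image of 𝕂^× under the structure map 𝕂 → R. -/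
open MvPolynomial in
/-- `X 1` is a nonzerodivisor modulo the quadric equation. -/
theorem mk_X_one_mem_nonZeroDivisors (K : Type*) [Field K] :
    Ideal.Quotient.mk (Ideal.span {(X 0 : MvPolynomial (Fin 3) K) ^ 2 - X 1 * X 2 - 1}) (X 1) ∈
      nonZeroDivisors (MvPolynomial (Fin 3) K ⧸
        Ideal.span {(X 0 : MvPolynomial (Fin 3) K) ^ 2 - X 1 * X 2 - 1}) := by
  rw [mem_nonZeroDivisors_iff_right]
  intro x hx
  obtain ⟨f, rfl⟩ := Ideal.Quotient.mk_surjective x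
  rw [← map_mul, Ideal.Quotient.eq_zero_iff_mem, Ideal.mem_span_singleton] at hx
  rw [Ideal.Quotient.eq_zero_iff_mem, Ideal.mem_span_singleton]
  obtain ⟨k, hk⟩ := hx
  have hX : Prime (X 1 : MvPolynomial (Fin 3) K) := X_prime
  have hdvd : (X 1 : MvPolynomial (Fin 3) K) ∣ k := by
    refine (hX.dvd_or_dvd (hk ▸ dvd_mul_left _ _)).resolve_left ?_
    rintro ⟨g, hg⟩
    have := congrArg (eval 0) hg
    simp at this
  obtain ⟨g, rfl⟩ := hdvd
  exact ⟨g, mul_right_cancel₀ hX.ne_zero (by rw [hk]; ring)⟩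

open MvPolynomial in
/-- The parametrization `(s, t) ↦ (1 + s t, t, s (2 + s t))` of the quadric surface
is injective on coordinate rings. -/
theorem exists_injective_quadric_algHom (K : Type*) [Field K] :
    ∃ φ : (MvPolynomial (Fin 3) K ⧸
        Ideal.span {(X 0 : MvPolynomial (Fin 3) K) ^ 2 - X 1 * X 2 - 1}) →ₐ[K]
        MvPolynomial (Fin 2) K, Function.Injective φ := by
  set I := Ideal.span {(X 0 : MvPolynomial (Fin 3) K) ^ 2 - X 1 * X 2 - 1}
  let T : Fin 3 → MvPolynomial (Fin 3) K ⧸ I := fun i => Ideal.Quotient.mk I (X i)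
  have hT : T 0 ^ 2 - T 1 * T 2 - 1 = 0 := by
    have : Ideal.Quotient.mk I (X 0 ^ 2 - X 1 * X 2 - 1) = 0 :=
      Ideal.Quotient.eq_zero_iff_mem.2 (Ideal.subset_span rfl)
    simpa [T] using this
  let p : Fin 3 → MvPolynomial (Fin 2) K :=
    ![1 + X 0 * X 1, X 1, X 0 * (2 + X 0 * X 1)]
  let φ : (MvPolynomial (Fin 3) K ⧸ I) →ₐ[K] MvPolynomial (Fin 2) K :=
    Ideal.Quotient.liftₐ I (aeval p) (by
      intro a ha
      obtain ⟨b, rfl⟩ := Ideal.mem_span_singleton.1 ha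
      rw [map_mul]
      convert zero_mul _
      simp [p]
      ring)
  let L := Localization.Away (T 1)
  let ι : (MvPolynomial (Fin 3) K ⧸ I) →ₐ[K] L := IsScalarTower.toAlgHom K _ L
  have hι : Function.Injective ι :=
    IsLocalization.injective L
      (Submonoid.powers_le.2 (mk_X_one_mem_nonZeroDivisors K))
  let u : L := IsLocalization.Away.invSelf (T 1)
  have hu : ι (T 1) * u = 1 := IsLocalization.Away.mul_invSelf (T 1)
  let ψ : MvPolynomial (Fin 2) K →ₐ[K] L := aeval ![(ι (T 0) - 1) * u, ι (T 1)]
  have hι0 : ι (T 0) ^ 2 - ι (T 1) * ι (T 2) - 1 = 0 := by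
    simpa using congrArg ι hT
  have hφ (i : Fin 3) : φ (T i) = p i := by
    change aeval p (X i) = p i
    simp
  have hcomp : ψ.comp φ = ι := by
    apply Ideal.Quotient.algHom_ext
    ext i
    change ψ (φ (T i)) = ι (T i)
    rw [hφ]
    fin_cases i
    · simp [p, ψ]
      linear_combination (ι (T 0) - 1) * hu
    · simp [p, ψ]
    · simp [p, ψ]
      linear_combination (ι (T 0) - 1) ^ 2 * u * hu + u * hι0 + ι (T 2) * hu
  refine ⟨φ, Function.Injective.of_comp (f := ψ) ?_⟩
  rw [← AlgHom.coe_comp, hcomp]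
  exact hι

open MvPolynomial in
/-- The units of the coordinate ring `𝕂[T₁,T₂,T₃]/(T₁² - T₂T₃ - 1)` of the smooth
affine quadric `V(T₁² - T₂T₃ - 1) ⊆ 𝕂³` are exactly the non-zero constants. -/
theorem statement14 (𝕂 : Type*) [Field 𝕂] [IsAlgClosed 𝕂] [CharZero 𝕂]
    (x : MvPolynomial (Fin 3) 𝕂 ⧸
      Ideal.span {(X 0 : MvPolynomial (Fin 3) 𝕂) ^ 2 - X 1 * X 2 - 1}) :
    IsUnit x ↔ ∃ c : 𝕂, c ≠ 0 ∧
      algebraMap 𝕂 (MvPolynomial (Fin 3) 𝕂 ⧸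
        Ideal.span {(X 0 : MvPolynomial (Fin 3) 𝕂) ^ 2 - X 1 * X 2 - 1}) c = x := by
  constructor
  · intro hx
    obtain ⟨φ, hφ⟩ := exists_injective_quadric_algHom 𝕂
    obtain ⟨c, hc, h⟩ := isUnit_iff_eq_C_of_isReduced.1 (hx.map φ)
    refine ⟨c, hc.ne_zero, hφ ?_⟩
    rw [φ.commutes, h, algebraMap_eq]
  · rintro ⟨c, hc, rfl⟩
    exact (IsUnit.mk0 c hc).map _
end

section
/- Let 𝕂 be an algebraically closed field of characteristic zero and let R = 𝕂[T₁, T₂, T₃]/(T₁² − T₂T₃ − 1). Then R is an integral domain and its ideal class group (the group of invertible fractional ideals modulo principal fractional ideals) is infinite cyclic, ClassGroup(R) ≅ ℤ. -/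
namespace Ideal

variable {R : Type*} [CommRing R]

theorem exists_eq_span_singleton_mul_of_le {I : Ideal R} {a : R} (h : I ≤ span {a}) :
    ∃ J : Ideal R, I = span {a} * J := by
  refine ⟨I.colon {a}, le_antisymm (fun x hx => ?_) ?_⟩
  · obtain ⟨y, rfl⟩ := mem_span_singleton.1 (h hx)
    exact mem_span_singleton_mul.2
      ⟨y, by simpa [Submodule.mem_colon_singleton, mul_comm] using hx, rfl⟩
  · rw [span_singleton_mul_le_iff]
    intro z hz
    simpa [Submodule.mem_colon_singleton, mul_comm] using hz

variable [IsDomain R]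

theorem exists_eq_mul_of_le_of_mul_eq_span_singleton {I P Q : Ideal R} {b : R} (hb : b ≠ 0)
    (hPQ : P * Q = span {b}) (h : I ≤ P) : ∃ J : Ideal R, I = P * J := by
  obtain ⟨J, hJ⟩ := exists_eq_span_singleton_mul_of_le ((mul_mono_left h).trans hPQ.le)
  refine ⟨J, (span_singleton_mul_right_inj hb).1 ?_⟩
  rw [mul_left_comm, ← hJ, mul_left_comm, hPQ, mul_comm]

theorem mul_left_cancel_of_mul_eq_span_singleton {I J P Q : Ideal R} {b : R} (hb : b ≠ 0)
    (hPQ : P * Q = span {b}) (h : P * I = P * J) : I = J := by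
  rw [← span_singleton_mul_right_inj hb, ← hPQ, mul_comm P, mul_assoc, h, mul_assoc]

/-- Unique factorization for divisors of a product of powers of two invertible primes. -/
theorem exists_eq_pow_mul_pow_of_mul_eq {P Q : Ideal R} [P.IsPrime] [Q.IsPrime] {b : R}
    (hb : b ≠ 0) (hPQ : P * Q = span {b}) (n m : ℕ) {I J : Ideal R}
    (h : I * J = P ^ n * Q ^ m) : ∃ i j : ℕ, I = P ^ i * Q ^ j := by
  have hQP : Q * P = span {b} := by rw [mul_comm, hPQ]
  induction n generalizing I J with
  | zero =>
    induction m generalizing I J with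
    | zero =>
      exact ⟨0, 0, by
        simpa using eq_top_iff.2 ((by simpa using h.ge : ⊤ ≤ I * J).trans mul_le_left)⟩
    | succ m ih =>
      have hle : I * J ≤ Q := by
        rw [h, pow_succ, ← mul_assoc]
        exact mul_le_right
      rcases (IsPrime.mul_le ‹_›).1 hle with hI | hJ
      · obtain ⟨I, rfl⟩ := exists_eq_mul_of_le_of_mul_eq_span_singleton hb hQP hI
        obtain ⟨i, j, rfl⟩ := ih (I := I) (J := J)
          (mul_left_cancel_of_mul_eq_span_singleton hb hQP (by rw [← mul_assoc, h]; ring))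
        exact ⟨i, j + 1, by ring⟩
      · obtain ⟨J, rfl⟩ := exists_eq_mul_of_le_of_mul_eq_span_singleton hb hQP hJ
        exact ih (J := J)
          (mul_left_cancel_of_mul_eq_span_singleton hb hQP (by rw [mul_left_comm, h]; ring))
  | succ n ih =>
    have hle : I * J ≤ P := by
      rw [h, pow_succ', mul_assoc]
      exact mul_le_left
    rcases (IsPrime.mul_le ‹_›).1 hle with hI | hJ
    · obtain ⟨I, rfl⟩ := exists_eq_mul_of_le_of_mul_eq_span_singleton hb hPQ hI
      obtain ⟨i, j, rfl⟩ := ih (I := I) (J := J)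
        (mul_left_cancel_of_mul_eq_span_singleton hb hPQ (by rw [← mul_assoc, h]; ring))
      exact ⟨i + 1, j, by ring⟩
    · obtain ⟨J, rfl⟩ := exists_eq_mul_of_le_of_mul_eq_span_singleton hb hPQ hJ
      exact ih (J := J)
        (mul_left_cancel_of_mul_eq_span_singleton hb hPQ (by rw [mul_left_comm, h]; ring))

/-- If inverting `b` makes `R` a GCD domain, then every invertible ideal is inverse, up to a
principal ideal, to an ideal dividing a power of `b`. -/
theorem exists_mul_eq_span_singleton_of_away {b : R} (hb : b ≠ 0) (S : Type*) [CommRing S]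
    [Algebra R S] [IsLocalization.Away b S] [IsDomain S] [IsGCDMonoid S]
    {I I' : Ideal R} {h : R} (hh : h ≠ 0) (hI : I * I' = span {h}) :
    ∃ (f : R) (J J' : Ideal R) (n : ℕ), f ≠ 0 ∧ I * J = span {f} ∧ J * J' = span {b ^ n} := by
  have hinj : Function.Injective (algebraMap R S) :=
    IsLocalization.injective S (powers_le_nonZeroDivisors_of_noZeroDivisors hb)
  have hmap : I.map (algebraMap R S) * I'.map (algebraMap R S) = span {algebraMap R S h} := by
    rw [← Ideal.map_mul, hI, map_span, Set.image_singleton]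
  have hh' : algebraMap R S h ≠ 0 := by simpa using hinj.ne hh
  obtain ⟨g, hg⟩ := (IsGCDMonoid.isPrincipal_of_exists_mul_ne_zero_isPrincipal
    (J := I.map (algebraMap R S)) ⟨I'.map (algebraMap R S), by simpa [hmap] using hh',
      ⟨_, hmap⟩⟩).principal
  change _ = span {g} at hg
  have hg0 : g ≠ 0 := by
    rintro rfl
    apply hh'
    rw [hg] at hmap
    simpa using hmap.symm
  obtain ⟨⟨⟨f, hf⟩, s⟩, hfs⟩ := (IsLocalization.mem_map_algebraMap_iff (Submonoid.powers b) S).1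
    (show g ∈ I.map (algebraMap R S) from hg ▸ mem_span_singleton_self g)
  have hs : IsUnit (algebraMap R S s) := IsLocalization.map_units S s
  replace hfs : g * algebraMap R S s = algebraMap R S f := hfs
  have hf0 : f ≠ 0 := by
    rintro rfl
    rw [map_zero] at hfs
    exact (mul_ne_zero hg0 hs.ne_zero) hfs
  obtain ⟨J, hJ⟩ := exists_eq_span_singleton_mul_of_le (I := span {f} * I') (a := h) (by
    rw [← hI, span_singleton_mul_le_iff]
    exact fun z hz => mul_mem_mul hf hz)
  have hIJ : I * J = span {f} := by
    rw [← span_singleton_mul_right_inj hh, mul_left_comm, ← hJ, mul_left_comm, hI, mul_comm]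
  have hJtop : J.map (algebraMap R S) = ⊤ := by
    have hf0' : algebraMap R S f ≠ 0 := by simpa using hinj.ne hf0
    rw [← span_singleton_mul_right_inj hf0', mul_top]
    have := congrArg (Ideal.map (algebraMap R S)) hIJ
    rw [Ideal.map_mul, map_span, Set.image_singleton, hg] at this
    rwa [← span_singleton_mul_right_unit hs g, hfs] at this
  obtain ⟨n, hn⟩ : ∃ n, b ^ n ∈ J := by
    by_contra! hJ
    refine (IsLocalization.map_algebraMap_ne_top_iff_disjoint (Submonoid.powers b) S J).2 ?_ hJtop
    rw [Set.disjoint_left]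
    rintro _ ⟨n, rfl⟩ hn
    exact hJ n hn
  obtain ⟨J', hJ'⟩ := exists_eq_span_singleton_mul_of_le (I := span {b ^ n} * I) (a := f) (by
    rw [← hIJ, span_singleton_mul_le_iff]
    exact fun z hz => mul_comm z (b ^ n) ▸ mul_mem_mul hz hn)
  refine ⟨f, J, J', n, hf0, hIJ, ?_⟩
  rw [← span_singleton_mul_right_inj hf0, mul_left_comm, ← hJ', mul_left_comm, mul_comm J, hIJ,
    mul_comm]

end Ideal

namespace ClassGroup

open scoped nonZeroDivisors

variable {R : Type*} [CommRing R] [IsDomain R]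

theorem isUnit_coeIdeal_of_mul_eq_span_singleton {I J : Ideal R} {f : R} (hf : f ≠ 0)
    (h : I * J = Ideal.span {f}) : IsUnit (I : FractionalIdeal R⁰ (FractionRing R)) := by
  have hf' : algebraMap R (FractionRing R) f ≠ 0 := by simpa using hf
  refine isUnit_of_mul_isUnit_left (y := (J : FractionalIdeal R⁰ (FractionRing R))) ?_
  rw [← FractionalIdeal.coeIdeal_mul, h, FractionalIdeal.coeIdeal_span_singleton]
  exact ⟨toPrincipalIdeal R (FractionRing R) (Units.mk0 _ hf'), by simp⟩

theorem exists_mul_eq_span_singleton_of_isUnit_coeIdeal {I : Ideal R}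
    (hI : IsUnit (I : FractionalIdeal R⁰ (FractionRing R))) :
    ∃ (J : Ideal R) (f : R), f ≠ 0 ∧ I * J = Ideal.span {f} := by
  obtain ⟨u, hu⟩ := hI
  obtain ⟨f, J, hf, hJ⟩ := FractionalIdeal.exists_eq_spanSingleton_mul (u⁻¹).1
  refine ⟨J, f, hf, (FractionalIdeal.coeIdeal_inj (K := FractionRing R)).1 ?_⟩
  have hf' : algebraMap R (FractionRing R) f ≠ 0 := by simpa using hf
  rw [FractionalIdeal.coeIdeal_mul, FractionalIdeal.coeIdeal_span_singleton]
  calc (I : FractionalIdeal R⁰ (FractionRing R)) * J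
      = FractionalIdeal.spanSingleton R⁰ (algebraMap R (FractionRing R) f) *
          (I * (FractionalIdeal.spanSingleton R⁰ (algebraMap R (FractionRing R) f)⁻¹ * J)) := by
        rw [mul_left_comm (I : FractionalIdeal R⁰ (FractionRing R)), ← mul_assoc,
          FractionalIdeal.spanSingleton_mul_spanSingleton, mul_inv_cancel₀ hf',
          FractionalIdeal.spanSingleton_one, one_mul]
    _ = _ := by rw [← hJ, ← hu, Units.mul_inv, mul_one]

/-- The class of an ideal that is invertible as a fractional ideal. -/
noncomputable def ofIsUnit (I : Ideal R) (hI : IsUnit (I : FractionalIdeal R⁰ (FractionRing R))) :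
    ClassGroup R :=
  ClassGroup.mk (FractionRing R) hI.unit

theorem ofIsUnit_eq_one_iff {I : Ideal R}
    {hI : IsUnit (I : FractionalIdeal R⁰ (FractionRing R))} :
    ofIsUnit I hI = 1 ↔ ∃ x : R, x ≠ 0 ∧ I = Ideal.span {x} :=
  ClassGroup.mk_eq_one_of_coe_ideal rfl

theorem ofIsUnit_mul {I J : Ideal R}
    (hI : IsUnit (I : FractionalIdeal R⁰ (FractionRing R)))
    (hJ : IsUnit (J : FractionalIdeal R⁰ (FractionRing R)))
    (hIJ : IsUnit ((I * J : Ideal R) : FractionalIdeal R⁰ (FractionRing R))) :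
    ofIsUnit (I * J) hIJ = ofIsUnit I hI * ofIsUnit J hJ := by
  rw [ofIsUnit, ofIsUnit, ofIsUnit, ← map_mul]
  congr 1
  ext1
  simp [FractionalIdeal.coeIdeal_mul]

theorem ofIsUnit_pow {I : Ideal R}
    (hI : IsUnit (I : FractionalIdeal R⁰ (FractionRing R))) (n : ℕ)
    (hIn : IsUnit ((I ^ n : Ideal R) : FractionalIdeal R⁰ (FractionRing R))) :
    ofIsUnit (I ^ n) hIn = ofIsUnit I hI ^ n := by
  rw [ofIsUnit, ofIsUnit, ← map_pow]
  congr 1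
  ext1
  simp [FractionalIdeal.coeIdeal_pow]

theorem exists_ofIsUnit (x : ClassGroup R) : ∃ I hI, x = ofIsUnit I hI := by
  refine ClassGroup.induction (FractionRing R) (fun I => ?_) x
  have hden : algebraMap R (FractionRing R) I.1.den ≠ 0 :=
    IsFractionRing.to_map_ne_zero_of_mem_nonZeroDivisors I.1.den.2
  refine ⟨I.1.num, FractionalIdeal.isUnit_num.2 ⟨I, rfl⟩, ?_⟩
  rw [ofIsUnit, ClassGroup.mk_eq_mk]
  refine ⟨Units.mk0 _ hden, ?_⟩
  ext1
  rw [mul_comm, Units.val_mul, coe_toPrincipalIdeal, Units.val_mk0, IsUnit.unit_spec]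
  exact FractionalIdeal.den_mul_self_eq_num' R⁰ (FractionRing R) I

/-- The class group of `R` is infinite cyclic if inverting an element `b` of `R` yields a
localization of a UFD `A ⊆ R` at a prime element, and `b` generates the product of two comaximal
primes of `R`. -/
theorem nonempty_mulEquiv_multiplicative_int {A : Type*} [CommRing A] [IsDomain A]
    [UniqueFactorizationMonoid A] [Algebra A R] (hinj : Function.Injective (algebraMap A R))
    {b : A} (hb : Prime b)
    (hloc : ∀ r : R, ∃ (n : ℕ) (a : A), algebraMap A R b ^ n * r = algebraMap A R a)
    {P Q : Ideal R} [hP : P.IsPrime] [hQ : Q.IsPrime]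
    (hPQ : P * Q = Ideal.span {algebraMap A R b}) (hsup : P ⊔ Q = ⊤) :
    Nonempty (ClassGroup R ≃* Multiplicative ℤ) := by
  have hb0 : algebraMap A R b ≠ 0 := by simpa using hinj.ne hb.ne_zero
  have hQP : Q * P = Ideal.span {algebraMap A R b} := by rw [mul_comm, hPQ]
  have hbP : algebraMap A R b ∈ P :=
    Ideal.mul_le_left (hPQ ▸ Ideal.mem_span_singleton_self (algebraMap A R b))
  have hbQ : algebraMap A R b ∈ Q :=
    Ideal.mul_le_left (hQP ▸ Ideal.mem_span_singleton_self (algebraMap A R b))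
  let S := Localization.Away (algebraMap A R b)
  have hle := powers_le_nonZeroDivisors_of_noZeroDivisors hb0
  have : IsDomain S := IsLocalization.isDomain_localization hle
  have hinjS : Function.Injective (algebraMap R S) := IsLocalization.injective S hle
  have hunit : IsUnit (algebraMap R S (algebraMap A R b)) :=
    IsLocalization.Away.algebraMap_isUnit _
  have : IsLocalization.Away b S :=
    { map_units := by
        rintro ⟨_, n, rfl⟩
        simpa [IsScalarTower.algebraMap_apply A R S] using hunit.pow n
      surj := by
        intro z
        obtain ⟨⟨r, ⟨_, n, rfl⟩⟩, hr⟩ := IsLocalization.surj (Submonoid.powers (algebraMap A R b)) z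
        obtain ⟨m, a, ha⟩ := hloc r
        refine ⟨⟨a, ⟨b ^ (n + m), n + m, rfl⟩⟩, ?_⟩
        simp only [IsScalarTower.algebraMap_apply A R S, ← ha, map_mul, map_pow, pow_add] at hr ⊢
        rw [← hr]
        ring
      exists_of_eq := by
        intro x y hxy
        rw [IsScalarTower.algebraMap_apply A R S, IsScalarTower.algebraMap_apply A R S] at hxy
        exact ⟨1, by rw [hinj (hinjS hxy)]⟩ }
  have : UniqueFactorizationMonoid S := .of_isLocalization (Submonoid.powers b) S
  have hPu := isUnit_coeIdeal_of_mul_eq_span_singleton hb0 hPQ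
  have hQu := isUnit_coeIdeal_of_mul_eq_span_singleton hb0 hQP
  have hpow {I : Ideal R} (hI : IsUnit (I : FractionalIdeal R⁰ (FractionRing R))) (n : ℕ) :
      IsUnit ((I ^ n : Ideal R) : FractionalIdeal R⁰ (FractionRing R)) := by
    rw [FractionalIdeal.coeIdeal_pow]
    exact hI.pow n
  have hmul {I J : Ideal R} (hI : IsUnit (I : FractionalIdeal R⁰ (FractionRing R)))
      (hJ : IsUnit (J : FractionalIdeal R⁰ (FractionRing R))) :
      IsUnit ((I * J : Ideal R) : FractionalIdeal R⁰ (FractionRing R)) := by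
    rw [FractionalIdeal.coeIdeal_mul]
    exact hI.mul hJ
  have hQinv : ofIsUnit Q hQu = (ofIsUnit P hPu)⁻¹ := by
    rw [eq_inv_iff_mul_eq_one, ← ofIsUnit_mul hQu hPu (hmul hQu hPu), ofIsUnit_eq_one_iff]
    exact ⟨_, hb0, hQP⟩
  have hsurj : Function.Surjective (zpowersHom (ClassGroup R) (ofIsUnit P hPu)) := by
    rw [← MonoidHom.range_eq_top, eq_top_iff]
    rintro x -
    obtain ⟨I, hI, rfl⟩ := exists_ofIsUnit x
    obtain ⟨I', h, hh, hII'⟩ := exists_mul_eq_span_singleton_of_isUnit_coeIdeal hI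
    obtain ⟨f, J, J', n, hf, hIJ, hJJ'⟩ :=
      Ideal.exists_mul_eq_span_singleton_of_away hb0 S hh hII'
    obtain ⟨i, j, rfl⟩ := Ideal.exists_eq_pow_mul_pow_of_mul_eq hb0 hPQ n n (I := J) (J := J')
      (by rw [hJJ', ← mul_pow, hPQ, Ideal.span_singleton_pow])
    have hJu := hmul (hpow hPu i) (hpow hQu j)
    have : ofIsUnit I hI = (ofIsUnit _ hJu)⁻¹ := by
      rw [eq_inv_iff_mul_eq_one, ← ofIsUnit_mul hI hJu (hmul hI hJu), ofIsUnit_eq_one_iff]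
      exact ⟨f, hf, hIJ⟩
    rw [this, ofIsUnit_mul (hpow hPu i) (hpow hQu j), ofIsUnit_pow hPu, ofIsUnit_pow hQu, hQinv]
    have hmem : ofIsUnit P hPu ∈ (zpowersHom (ClassGroup R) (ofIsUnit P hPu)).range :=
      ⟨.ofAdd 1, by simp⟩
    exact inv_mem (mul_mem (pow_mem hmem i) (pow_mem (inv_mem hmem) j))
  have hnonprincipal (n : ℕ) (hn : n ≠ 0) (f : R) : P ^ n ≠ Ideal.span {f} := by
    intro hf
    obtain ⟨g, hg⟩ := Ideal.mem_span_singleton.1 (hf ▸ Ideal.pow_mem_pow hbP n)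
    obtain ⟨k, F, hF⟩ := hloc f
    obtain ⟨l, G, hG⟩ := hloc g
    have hFG : F * G = b ^ (k + l + n) := hinj (by
      rw [map_mul, ← hF, ← hG, map_pow, pow_add, hg]
      ring)
    obtain ⟨i, -, u, hu⟩ := (dvd_prime_pow hb _).1 (Dvd.intro G hFG)
    replace hu : algebraMap A R b ^ k * f * algebraMap A R u = algebraMap A R b ^ i := by
      rw [hF, ← map_mul, hu, map_pow]
    have hu' : IsUnit (algebraMap A R u) := u.isUnit.map _
    have hle : P ^ n ≤ P := Ideal.pow_le_self hn
    have hfP : f ∈ P := hle (hf ▸ Ideal.mem_span_singleton_self f)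
    rcases lt_or_ge k i with hki | hki
    · obtain ⟨d, rfl⟩ := Nat.exists_eq_add_of_lt hki
      have hfu : f * algebraMap A R u = algebraMap A R b ^ (d + 1) :=
        mul_left_cancel₀ (pow_ne_zero k hb0) (by rw [← mul_assoc, hu]; ring)
      have hfQ : f ∈ Q := by
        rw [← Ideal.mul_unit_mem_iff_mem Q hu', hfu]
        exact Ideal.pow_mem_of_mem Q hbQ _ d.succ_pos
      have hPQle : P ≤ Q := hQ.le_of_pow_le (n := n)
        (hf ▸ (Ideal.span_singleton_le_iff_mem _).2 hfQ)
      exact hQ.ne_top (by rwa [sup_eq_right.2 hPQle] at hsup)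
    · obtain ⟨d, rfl⟩ := Nat.exists_eq_add_of_le hki
      have hfu : algebraMap A R b ^ d * f * algebraMap A R u = 1 :=
        mul_left_cancel₀ (pow_ne_zero i hb0) (by linear_combination hu)
      refine hP.ne_top ((Ideal.eq_top_iff_one P).2 (hfu ▸ ?_))
      exact P.mul_mem_right _ (P.mul_mem_left _ hfP)
  have hinj' : Function.Injective (zpowersHom (ClassGroup R) (ofIsUnit P hPu)) := by
    have hnat (n : ℕ) (h : ofIsUnit P hPu ^ n = 1) : n = 0 := by
      by_contra hn
      rw [← ofIsUnit_pow hPu n (hpow hPu n), ofIsUnit_eq_one_iff] at h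
      obtain ⟨f, -, hf⟩ := h
      exact hnonprincipal n hn f hf
    rw [injective_iff_map_eq_one]
    intro z hz
    rw [zpowersHom_apply] at hz
    obtain ⟨n, hn | hn⟩ := Int.eq_nat_or_neg z.toAdd
    · rw [hn, zpow_natCast] at hz
      rw [hnat n hz] at hn
      exact hn
    · rw [hn, zpow_neg, inv_eq_one, zpow_natCast] at hz
      rw [hnat n hz] at hn
      exact hn
  exact ⟨(MulEquiv.ofBijective _ ⟨hinj', hsurj⟩).symm⟩

end ClassGroup

namespace MvPolynomial

/-- The coordinate ring of the affine quadric `T₀² - T₁T₂ = 1`. -/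
abbrev QuadricRing (K : Type*) [CommRing K] : Type _ :=
  MvPolynomial (Fin 3) K ⧸ Ideal.span {(X 0 : MvPolynomial (Fin 3) K) ^ 2 - X 1 * X 2 - 1}

namespace QuadricRing

section CommRing

variable {K : Type*} [CommRing K]

variable (K) in
/-- The `i`-th coordinate function. -/
noncomputable abbrev coord (i : Fin 3) : QuadricRing K :=
  Ideal.Quotient.mk _ (X i)

theorem coord_mul_coord : coord K 1 * coord K 2 = coord K 0 ^ 2 - 1 := by
  rw [eq_comm, ← sub_eq_zero, ← map_mul, ← map_pow, ← map_one (Ideal.Quotient.mk _), ← map_sub,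
    ← map_sub, Ideal.Quotient.eq_zero_iff_mem]
  convert Ideal.mem_span_singleton_self _ using 1
  ring

/-- The algebra homomorphism out of the coordinate ring given by a point of the quadric. -/
noncomputable def lift {B : Type*} [CommRing B] [Algebra K B] (x : Fin 3 → B)
    (hx : x 0 ^ 2 - x 1 * x 2 - 1 = 0) : QuadricRing K →ₐ[K] B :=
  Ideal.Quotient.liftₐ _ (aeval x) fun a ha => by
    obtain ⟨q, rfl⟩ := Ideal.mem_span_singleton.1 ha
    simp [hx]

@[simp]
theorem lift_coord {B : Type*} [CommRing B] [Algebra K B] (x : Fin 3 → B)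
    (hx : x 0 ^ 2 - x 1 * x 2 - 1 = 0) (i : Fin 3) : lift x hx (coord K i) = x i :=
  aeval_X x i

theorem algHom_ext {B : Type*} [Semiring B] [Algebra K B] {f g : QuadricRing K →ₐ[K] B}
    (h : ∀ i, f (coord K i) = g (coord K i)) : f = g :=
  Ideal.Quotient.algHom_ext _ (MvPolynomial.algHom_ext h)

variable (K) in
/-- The inclusion of the polynomial ring in the first two coordinates. -/
noncomputable def ofPlane : MvPolynomial (Fin 2) K →ₐ[K] QuadricRing K :=
  aeval ![coord K 0, coord K 1]

@[simp]
theorem ofPlane_X_zero : ofPlane K (X 0) = coord K 0 := by simp [ofPlane]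

@[simp]
theorem ofPlane_X_one : ofPlane K (X 1) = coord K 1 := by simp [ofPlane]

theorem exists_pow_mul_eq_ofPlane (r : QuadricRing K) :
    ∃ (n : ℕ) (a : MvPolynomial (Fin 2) K), coord K 1 ^ n * r = ofPlane K a := by
  obtain ⟨p, rfl⟩ := Ideal.Quotient.mk_surjective r
  induction p using MvPolynomial.induction_on with
  | C k => exact ⟨0, C k, by rw [pow_zero, one_mul]; exact ((ofPlane K).commutes k).symm⟩
  | add p q hp hq =>
    obtain ⟨n, a, ha⟩ := hp
    obtain ⟨m, b, hb⟩ := hq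
    refine ⟨n + m, X 1 ^ m * a + X 1 ^ n * b, ?_⟩
    simp only [map_add, map_mul, map_pow, ofPlane_X_one, ← ha, ← hb]
    ring
  | mul_X p i hp =>
    obtain ⟨n, a, ha⟩ := hp
    rw [map_mul]
    fin_cases i
    · refine ⟨n, a * X 0, ?_⟩
      rw [map_mul, ofPlane_X_zero, ← ha, mul_assoc]
      rfl
    · refine ⟨n, a * X 1, ?_⟩
      rw [map_mul, ofPlane_X_one, ← ha, mul_assoc]
      rfl
    · refine ⟨n + 1, a * (X 0 ^ 2 - 1), ?_⟩
      rw [map_mul, map_sub, map_pow, map_one, ofPlane_X_zero, ← ha, ← coord_mul_coord]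
      change _ * (_ * coord K 2) = _
      ring

/-- The prime ideal of the line `T₀ = e`, `T₁ = 0` on the quadric, where `e ^ 2 = 1`. -/
noncomputable abbrev lineIdeal (e : K) : Ideal (QuadricRing K) :=
  Ideal.span {coord K 0 - algebraMap K _ e, coord K 1}

theorem lineIdeal_isPrime [IsDomain K] {e : K} (he : e ^ 2 = 1) : (lineIdeal e).IsPrime := by
  let ψ : QuadricRing K →ₐ[K] Polynomial K :=
    lift ![Polynomial.C e, 0, Polynomial.X] (by simp [← map_pow, he])
  let mk := Ideal.Quotient.mkₐ K (lineIdeal e)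
  have hmk : mk = (Polynomial.aeval (mk (coord K 2))).comp ψ := by
    apply QuadricRing.algHom_ext
    intro i
    fin_cases i
    · change mk (coord K 0) = Polynomial.aeval (mk (coord K 2)) (ψ (coord K 0))
      rw [lift_coord, ← sub_eq_zero]
      simp only [Matrix.cons_val_zero, Polynomial.aeval_C]
      rw [← mk.commutes e, ← map_sub]
      exact Ideal.Quotient.eq_zero_iff_mem.2 (Ideal.subset_span (by simp))
    · change mk (coord K 1) = Polynomial.aeval (mk (coord K 2)) (ψ (coord K 1))
      rw [lift_coord]
      simp only [Matrix.cons_val_one, Matrix.cons_val_zero, map_zero]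
      exact Ideal.Quotient.eq_zero_iff_mem.2 (Ideal.subset_span (by simp))
    · change mk (coord K 2) = Polynomial.aeval (mk (coord K 2)) (ψ (coord K 2))
      rw [lift_coord]
      simp
  have hker : lineIdeal e = RingHom.ker ψ := by
    refine le_antisymm (Ideal.span_le.2 ?_) fun r hr => ?_
    · rintro _ (rfl | rfl)
      · simp only [SetLike.mem_coe, RingHom.mem_ker, map_sub, AlgHom.commutes]
        simp [ψ]
      · simp [RingHom.mem_ker, ψ]
    · refine Ideal.Quotient.eq_zero_iff_mem.1 ?_
      change mk r = 0
      rw [hmk, AlgHom.comp_apply, RingHom.mem_ker.1 hr, map_zero]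
  rw [hker]
  exact RingHom.ker_isPrime _

end CommRing

section Field

variable {K : Type*} [Field K]

theorem coord_one_mul_eq_zero {r : QuadricRing K} (h : coord K 1 * r = 0) : r = 0 := by
  obtain ⟨p, rfl⟩ := Ideal.Quotient.mk_surjective r
  rw [← map_mul, Ideal.Quotient.eq_zero_iff_mem, Ideal.mem_span_singleton] at h
  obtain ⟨q, hq⟩ := h
  have hX : Prime (X 1 : MvPolynomial (Fin 3) K) := X_prime
  rcases hX.dvd_or_dvd (Dvd.intro p hq) with ⟨s, hs⟩ | ⟨s, rfl⟩
  · simpa using congrArg (eval 0) hs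
  · rw [Ideal.Quotient.eq_zero_iff_mem, Ideal.mem_span_singleton]
    refine ⟨s, mul_left_cancel₀ hX.ne_zero ?_⟩
    rw [hq]
    ring

variable (K) in
/-- The embedding of the coordinate ring into the field of rational functions. -/
noncomputable def toFractionRing :
    QuadricRing K →ₐ[K] FractionRing (MvPolynomial (Fin 2) K) :=
  let x (i : Fin 2) := algebraMap (MvPolynomial (Fin 2) K) (FractionRing (MvPolynomial (Fin 2) K))
    (X i)
  lift ![x 0, x 1, (x 0 ^ 2 - 1) / x 1] (by
    have : x 1 ≠ 0 := by simp [x]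
    simp [mul_div_cancel₀ _ this])

theorem toFractionRing_ofPlane (a : MvPolynomial (Fin 2) K) :
    toFractionRing K (ofPlane K a) = algebraMap _ _ a := by
  have : (toFractionRing K).comp (ofPlane K) = IsScalarTower.toAlgHom K _ _ := by
    refine MvPolynomial.algHom_ext fun i => ?_
    fin_cases i <;> simp [toFractionRing]
  exact DFunLike.congr_fun this a

theorem ofPlane_injective : Function.Injective (ofPlane K) := fun a b h =>
  IsFractionRing.injective (MvPolynomial (Fin 2) K) (FractionRing (MvPolynomial (Fin 2) K)) (by
    rw [← toFractionRing_ofPlane, h, toFractionRing_ofPlane])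

theorem toFractionRing_injective : Function.Injective (toFractionRing K) := by
  rw [injective_iff_map_eq_zero]
  intro r hr
  obtain ⟨n, a, ha⟩ := exists_pow_mul_eq_ofPlane r
  have ha0 : a = 0 := by
    have := congrArg (toFractionRing K) ha
    rwa [map_mul, hr, mul_zero, toFractionRing_ofPlane, eq_comm,
      FaithfulSMul.algebraMap_eq_zero_iff] at this
  rw [ha0, map_zero] at ha
  induction n with
  | zero => simpa using ha
  | succ n ih => exact ih (coord_one_mul_eq_zero (by rw [← mul_assoc, ← pow_succ', ha]))

instance : IsDomain (QuadricRing K) :=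
  toFractionRing_injective.isDomain _

theorem lineIdeal_sup_lineIdeal (h2 : (2 : K) ≠ 0) :
    lineIdeal (1 : K) ⊔ lineIdeal (-1 : K) = ⊤ := by
  rw [Ideal.eq_top_iff_one]
  have h1 : coord K 0 - 1 ∈ lineIdeal (1 : K) := Ideal.subset_span (by simp)
  have h3 : coord K 0 + 1 ∈ lineIdeal (-1 : K) := Ideal.subset_span (by simp)
  have h4 := (lineIdeal (1 : K) ⊔ lineIdeal (-1 : K)).mul_mem_left (algebraMap K _ (2⁻¹))
    (sub_mem (Ideal.mem_sup_right h3) (Ideal.mem_sup_left h1))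
  convert h4
  rw [add_sub_sub_cancel, one_add_one_eq_two, ← map_ofNat (algebraMap K (QuadricRing K)) 2,
    ← map_mul, inv_mul_cancel₀ h2, map_one]

theorem lineIdeal_mul_lineIdeal (h2 : (2 : K) ≠ 0) :
    lineIdeal (1 : K) * lineIdeal (-1 : K) = Ideal.span {coord K 1} := by
  apply le_antisymm
  · rw [Ideal.span_mul_span, Ideal.span_le]
    rintro _ ⟨x, hx, y, hy, rfl⟩
    rw [SetLike.mem_coe, Ideal.mem_span_singleton]
    rcases hx with rfl | rfl
    · rcases hy with rfl | rfl
      · refine ⟨coord K 2, ?_⟩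
        rw [coord_mul_coord]
        simp only [map_one, map_neg]
        ring
      · exact Dvd.intro_left _ rfl
    · exact Dvd.intro _ rfl
  · rw [Ideal.mul_eq_inf_of_coprime (lineIdeal_sup_lineIdeal h2), le_inf_iff]
    simp only [Ideal.span_singleton_le_iff_mem]
    exact ⟨Ideal.subset_span (by simp), Ideal.subset_span (by simp)⟩

theorem nonempty_classGroup_mulEquiv (h2 : (2 : K) ≠ 0) :
    Nonempty (ClassGroup (QuadricRing K) ≃* Multiplicative ℤ) := by
  let : Algebra (MvPolynomial (Fin 2) K) (QuadricRing K) := (ofPlane K).toRingHom.toAlgebra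
  have := lineIdeal_isPrime (K := K) (e := 1) (by simp)
  have := lineIdeal_isPrime (K := K) (e := -1) (by simp)
  have hX : algebraMap (MvPolynomial (Fin 2) K) (QuadricRing K) (X 1) = coord K 1 := ofPlane_X_one
  refine ClassGroup.nonempty_mulEquiv_multiplicative_int (A := MvPolynomial (Fin 2) K)
    (P := lineIdeal 1) (Q := lineIdeal (-1)) ofPlane_injective (b := X 1) X_prime ?_ ?_
    (lineIdeal_sup_lineIdeal h2)
  · rw [hX]
    exact exists_pow_mul_eq_ofPlane
  · rw [hX]
    exact lineIdeal_mul_lineIdeal h2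

end Field

end QuadricRing

end MvPolynomial

open MvPolynomial in
/-- The coordinate ring `R = 𝕂[T₁,T₂,T₃]/(T₁² - T₂T₃ - 1)` is an integral domain and
its ideal class group is infinite cyclic: `ClassGroup R ≅ ℤ`. -/
theorem statement15 (𝕂 : Type*) [Field 𝕂] [IsAlgClosed 𝕂] [CharZero 𝕂] :
    ∃ _ : IsDomain (MvPolynomial (Fin 3) 𝕂 ⧸
        Ideal.span {(X 0 : MvPolynomial (Fin 3) 𝕂) ^ 2 - X 1 * X 2 - 1}),
      Nonempty (ClassGroup (MvPolynomial (Fin 3) 𝕂 ⧸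
        Ideal.span {(X 0 : MvPolynomial (Fin 3) 𝕂) ^ 2 - X 1 * X 2 - 1})
          ≃* Multiplicative ℤ) := by
  exact ⟨inferInstance, MvPolynomial.QuadricRing.nonempty_classGroup_mulEquiv two_ne_zero⟩
end

section
/- Let 𝕂 be an algebraically closed field of characteristic zero, let σ be the 𝕂-algebra involution of the Laurent polynomial ring 𝕂[t₁^{±1}, t₂^{±1}] determined by σ(t₁) = t₁⁻¹ and σ(t₂) = t₂⁻¹, and let φ : 𝕂[X, Y, Z] → 𝕂[t₁^{±1}, t₂^{±1}] be the 𝕂-algebra homomorphism with φ(X) = t₁ + t₁⁻¹, φ(Y) = t₂ + t₂⁻¹, φ(Z) = t₁t₂ + t₁⁻¹t₂⁻¹. Then the image of φ is exactly the subalgebra of σ-invariants of 𝕂[t₁^{±1}, t₂^{±1}], and the kernel of φ is the principal ideal generated by XYZ − X² − Y² − Z² + 4; consequently φ induces an isomorphism 𝕂[X, Y, Z]/(XYZ − X² − Y² − Z² + 4) ≅ 𝕂[t₁^{±1}, t₂^{±1}]^{σ}. -/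
section

open MvPolynomial AddMonoidAlgebra

variable {K : Type*} [Field K]

/-- The symmetrized monomial `t ^ v + t ^ (-v)`. -/
noncomputable def symMonomial (K : Type*) [Field K] (v : ℤ × ℤ) : AddMonoidAlgebra K (ℤ × ℤ) :=
  single v 1 + single (-v) 1

lemma symMonomial_mul (v w : ℤ × ℤ) :
    symMonomial K v * symMonomial K w = symMonomial K (v + w) + symMonomial K (v - w) := by
  simp only [symMonomial, mul_add, add_mul, single_mul_single, mul_one, neg_add,
    sub_eq_add_neg, neg_neg]
  abel

lemma symMonomial_zero : symMonomial K 0 = 2 := by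
  rw [symMonomial, neg_zero, ← AddMonoidAlgebra.one_def, one_add_one_eq_two]

lemma symMonomial_add_zsmul_mem {S : Subalgebra K (AddMonoidAlgebra K (ℤ × ℤ))} {v w : ℤ × ℤ}
    (hw : symMonomial K w ∈ S) (h0 : symMonomial K v ∈ S) (h1 : symMonomial K (v + w) ∈ S)
    (n : ℤ) : symMonomial K (v + n • w) ∈ S := by
  have step (u : ℤ × ℤ) (hu : symMonomial K u ∈ S) :
      symMonomial K (u + w) ∈ S ↔ symMonomial K (u - w) ∈ S := by
    have h := S.mul_mem hu hw
    rw [symMonomial_mul] at h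
    exact ⟨fun h' => (add_mem_cancel_left h').1 h, fun h' => (add_mem_cancel_right h').1 h⟩
  suffices symMonomial K (v + n • w) ∈ S ∧ symMonomial K (v + (n + 1) • w) ∈ S from this.1
  induction n using Int.induction_on with
  | zero => simpa using ⟨h0, h1⟩
  | succ i ih =>
    refine ⟨ih.2, ?_⟩
    rw [add_smul (_ + 1 : ℤ), one_smul, ← add_assoc, step _ ih.2]
    convert ih.1 using 2
    module
  | pred i ih =>
    have h := ih.2
    rw [add_smul, one_smul, ← add_assoc, step _ ih.1] at h
    refine ⟨?_, ?_⟩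
    · convert h using 2
      module
    · convert ih.1 using 2
      module

lemma symMonomial_mem {S : Subalgebra K (AddMonoidAlgebra K (ℤ × ℤ))}
    (h10 : symMonomial K (1, 0) ∈ S) (h01 : symMonomial K (0, 1) ∈ S)
    (h11 : symMonomial K (1, 1) ∈ S) (v : ℤ × ℤ) : symMonomial K v ∈ S := by
  have h00 : symMonomial K 0 ∈ S := by
    rw [symMonomial_zero]
    exact ofNat_mem S 2
  have row0 (a : ℤ) : symMonomial K (a, 0) ∈ S := by
    simpa using symMonomial_add_zsmul_mem h10 h00 (by simpa using h10) a
  have row1 (a : ℤ) : symMonomial K (a, 1) ∈ S := by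
    simpa using symMonomial_add_zsmul_mem (v := (0, 1)) h10 h01 (by simpa using h11) a
  simpa using symMonomial_add_zsmul_mem h01 (row0 v.1) (by simpa using row1 v.1) v.2

lemma algHom_single_eq_single_neg
    {σ : AddMonoidAlgebra K (ℤ × ℤ) →ₐ[K] AddMonoidAlgebra K (ℤ × ℤ)}
    (h1 : σ (single (1, 0) 1) = single (-1, 0) 1) (h2 : σ (single (0, 1) 1) = single (0, -1) 1)
    (v : ℤ × ℤ) : σ (single v 1) = single (-v) 1 := by
  let f : Multiplicative (ℤ × ℤ) →* AddMonoidAlgebra K (ℤ × ℤ) :=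
    (σ : AddMonoidAlgebra K (ℤ × ℤ) →* AddMonoidAlgebra K (ℤ × ℤ)).comp (of K (ℤ × ℤ))
  let g : Multiplicative (ℤ × ℤ) →* AddMonoidAlgebra K (ℤ × ℤ) :=
    (of K (ℤ × ℤ)).comp (AddMonoidHom.toMultiplicative (-AddMonoidHom.id (ℤ × ℤ)))
  have hzpow (u : ℤ × ℤ) (hu : f (.ofAdd u) = g (.ofAdd u)) (n : ℤ) :
      f (.ofAdd (n • u)) = g (.ofAdd (n • u)) := by
    have key : (f.comp (zpowersHom _ (Multiplicative.ofAdd u))) =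
        g.comp (zpowersHom _ (Multiplicative.ofAdd u)) :=
      MonoidHom.ext_mint (by simpa using hu)
    simpa only [MonoidHom.comp_apply, zpowersHom_apply, toAdd_ofAdd, ofAdd_zsmul] using
      DFunLike.congr_fun key (Multiplicative.ofAdd n)
  have e1 := hzpow (1, 0) (by simpa [f, g] using h1) v.1
  have e2 := hzpow (0, 1) (by simpa [f, g] using h2) v.2
  have hv : Multiplicative.ofAdd v =
      Multiplicative.ofAdd (v.1 • ((1, 0) : ℤ × ℤ)) * Multiplicative.ofAdd (v.2 • (0, 1)) := by
    rw [← ofAdd_add]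
    simp
  have : f (.ofAdd v) = g (.ofAdd v) := by rw [hv, map_mul, map_mul, e1, e2]
  simpa [f, g] using this

lemma add_apply_mem_of_single_neg {S : Subalgebra K (AddMonoidAlgebra K (ℤ × ℤ))}
    {σ : AddMonoidAlgebra K (ℤ × ℤ) →ₐ[K] AddMonoidAlgebra K (ℤ × ℤ)}
    (hσ : ∀ v, σ (single v 1) = single (-v) 1) (hS : ∀ v, symMonomial K v ∈ S)
    (f : AddMonoidAlgebra K (ℤ × ℤ)) : f + σ f ∈ S := by
  induction f using AddMonoidAlgebra.induction_on with
  | of v =>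
    have h := hS v
    rwa [symMonomial, ← hσ] at h
  | add f g hf hg =>
    rw [map_add, add_add_add_comm]
    exact S.add_mem hf hg
  | smul r f hf =>
    rw [map_smul, ← smul_add]
    exact S.smul_mem hf r

/-- The polynomial `XYZ - X² - Y² - Z² + 4`. -/
noncomputable def cayleyCubic (K : Type*) [Field K] : MvPolynomial (Fin 3) K :=
  X 0 * X 1 * X 2 - X 0 ^ 2 - X 1 ^ 2 - X 2 ^ 2 + 4

lemma exists_sub_mem_span_cayleyCubic (F : MvPolynomial (Fin 3) K) :
    ∃ A B : MvPolynomial (Fin 2) K,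
      F - (rename Fin.castSucc A + rename Fin.castSucc B * X 2) ∈ Ideal.span {cayleyCubic K} := by
  have h0 : (X 0 : MvPolynomial (Fin 3) K) = rename Fin.castSucc (X (0 : Fin 2)) := by simp
  have h1 : (X 1 : MvPolynomial (Fin 3) K) = rename Fin.castSucc (X (1 : Fin 2)) := by simp
  simp only [Ideal.mem_span_singleton']
  induction F using MvPolynomial.induction_on with
  | C a => exact ⟨C a, 0, 0, by simp⟩
  | add F G hF hG =>
    obtain ⟨A, B, c, h⟩ := hF
    obtain ⟨A', B', c', h'⟩ := hG
    refine ⟨A + A', B + B', c + c', ?_⟩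
    rw [map_add, map_add]
    linear_combination h + h'
  | mul_X F i hF =>
    obtain ⟨A, B, c, h⟩ := hF
    fin_cases i
    · refine ⟨A * X 0, B * X 0, c * X 0, ?_⟩
      simp only [map_mul, ← h0, Fin.zero_eta]
      linear_combination X 0 * h
    · refine ⟨A * X 1, B * X 1, c * X 1, ?_⟩
      simp only [map_mul, ← h1, Fin.mk_one]
      linear_combination X 1 * h
    · refine ⟨B * (4 - X 0 ^ 2 - X 1 ^ 2), A + B * X 0 * X 1, c * X 2 - rename Fin.castSucc B, ?_⟩
      simp only [map_mul, map_add, map_sub, map_pow, map_ofNat, ← h0, ← h1, Fin.reduceFinMk]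
      rw [sub_mul, mul_right_comm, h, cayleyCubic]
      ring

/-- Evaluation of Laurent polynomials at a pair of units. -/
noncomputable def laurentEval (s t : Kˣ) : AddMonoidAlgebra K (ℤ × ℤ) →ₐ[K] K :=
  AddMonoidAlgebra.lift K K (ℤ × ℤ)
    { toFun := fun v => ((s ^ v.toAdd.1 * t ^ v.toAdd.2 : Kˣ) : K)
      map_one' := by simp
      map_mul' := fun v w => by
        rw [← Units.val_mul, mul_mul_mul_comm, ← zpow_add, ← zpow_add]
        rfl }

lemma laurentEval_single (s t : Kˣ) (v : ℤ × ℤ) :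
    laurentEval s t (single v 1) = ((s ^ v.1 * t ^ v.2 : Kˣ) : K) := by
  simp [laurentEval]

lemma exists_unit_add_inv [IsAlgClosed K] [CharZero K] (p : K) :
    ∃ s : Kˣ, (s : K) + (s⁻¹ : Kˣ) = p := by
  obtain ⟨r, hr⟩ := IsAlgClosed.exists_pow_nat_eq (p ^ 2 - 4) two_pos
  exact ⟨⟨(p + r) / 2, (p - r) / 2, by linear_combination -hr / 4, by linear_combination -hr / 4⟩,
    by simp only [Units.inv_mk]; ring⟩

/-- The homomorphism sending `X, Y, Z` to the symmetrized monomials `t₁ + t₁⁻¹`, `t₂ + t₂⁻¹`,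
`t₁ t₂ + t₁⁻¹ t₂⁻¹`. -/
noncomputable def traceHom (K : Type*) [Field K] :
    MvPolynomial (Fin 3) K →ₐ[K] AddMonoidAlgebra K (ℤ × ℤ) :=
  aeval ![symMonomial K (1, 0), symMonomial K (0, 1), symMonomial K (1, 1)]

lemma laurentEval_traceHom (s t : Kˣ) (F : MvPolynomial (Fin 3) K) :
    laurentEval s t (traceHom K F) =
      eval ![(s : K) + (s⁻¹ : Kˣ), (t : K) + (t⁻¹ : Kˣ),
        (s : K) * t + (s⁻¹ : Kˣ) * (t⁻¹ : Kˣ)] F := by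
  rw [← MvPolynomial.coe_aeval_eq_eval]
  change (laurentEval s t).comp (traceHom K) F = aeval _ F
  congr 1
  ext i
  fin_cases i <;> simp [traceHom, symMonomial, laurentEval_single]

lemma symMonomial_mem_range_traceHom (v : ℤ × ℤ) : symMonomial K v ∈ (traceHom K).range :=
  symMonomial_mem ((AlgHom.mem_range _).2 ⟨X 0, by simp [traceHom]⟩)
    ((AlgHom.mem_range _).2 ⟨X 1, by simp [traceHom]⟩)
    ((AlgHom.mem_range _).2 ⟨X 2, by simp [traceHom]⟩) v

lemma traceHom_cayleyCubic : traceHom K (cayleyCubic K) = 0 := by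
  have h12 := symMonomial_mul (K := K) (1, 0) (0, 1)
  have h11 := symMonomial_mul (K := K) (1, 1) (1, -1)
  have h1 := symMonomial_mul (K := K) (1, 0) (1, 0)
  have h2 := symMonomial_mul (K := K) (0, 1) (0, 1)
  simp only [Prod.mk_add_mk, Prod.mk_sub_mk, add_zero, zero_add, sub_zero, zero_sub, sub_self,
    sub_neg_eq_add, add_neg_cancel, symMonomial_zero] at h12 h11 h1 h2
  simp only [cayleyCubic, traceHom, map_add, map_sub, map_mul, map_pow, map_ofNat, aeval_X,
    Matrix.cons_val]
  linear_combination symMonomial K (1, 1) * h12 + h11 - h1 - h2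

lemma eq_zero_of_traceHom_eq_zero [IsAlgClosed K] [CharZero K] {A B : MvPolynomial (Fin 2) K}
    (h : traceHom K (rename Fin.castSucc A + rename Fin.castSucc B * X 2) = 0) :
    A = 0 ∧ B = 0 := by
  have key (s t : Kˣ) : eval ![(s : K) + (s⁻¹ : Kˣ), (t : K) + (t⁻¹ : Kˣ)] A +
      eval ![(s : K) + (s⁻¹ : Kˣ), (t : K) + (t⁻¹ : Kˣ)] B *
        ((s : K) * t + (s⁻¹ : Kˣ) * (t⁻¹ : Kˣ)) = 0 := by
    have e := laurentEval_traceHom s t (rename Fin.castSucc A + rename Fin.castSucc B * X 2)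
    have hcomp (p q r : K) : ![p, q, r] ∘ Fin.castSucc = ![p, q] := by
      ext i
      fin_cases i <;> rfl
    rw [h, map_zero, map_add, map_mul, eval_rename, eval_rename, hcomp, eval_X] at e
    exact e.symm
  have hB : B = 0 := by
    have hprod : B * ((X 0 ^ 2 - 4) * (X 1 ^ 2 - 4)) = 0 := by
      refine MvPolynomial.funext fun x => ?_
      obtain ⟨s, hs⟩ := exists_unit_add_inv (x 0)
      obtain ⟨t, ht⟩ := exists_unit_add_inv (x 1)
      have hx : ![x 0, x 1] = x := by
        ext i
        fin_cases i <;> rfl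
      have k1 := key s t
      have k2 := key s t⁻¹
      rw [inv_inv, add_comm ((t⁻¹ : Kˣ) : K) t] at k2
      rw [hs, ht, hx] at k1 k2
      simp only [map_mul, map_sub, map_pow, eval_X, map_ofNat, map_zero]
      rw [← hs, ← ht]
      have us : (s : K) * (s⁻¹ : Kˣ) = 1 := s.mul_inv
      have ut : (t : K) * (t⁻¹ : Kˣ) = 1 := t.mul_inv
      have d : eval x B * (((s : K) - (s⁻¹ : Kˣ)) * ((t : K) - (t⁻¹ : Kˣ))) = 0 := by
        linear_combination k1 - k2
      have ds : ((s : K) + (s⁻¹ : Kˣ)) ^ 2 - 4 = ((s : K) - (s⁻¹ : Kˣ)) ^ 2 := by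
        linear_combination 4 * us
      have dt : ((t : K) + (t⁻¹ : Kˣ)) ^ 2 - 4 = ((t : K) - (t⁻¹ : Kˣ)) ^ 2 := by
        linear_combination 4 * ut
      rw [ds, dt]
      linear_combination (((s : K) - (s⁻¹ : Kˣ)) * ((t : K) - (t⁻¹ : Kˣ))) * d
    have hX (i : Fin 2) : (X i ^ 2 - 4 : MvPolynomial (Fin 2) K) ≠ 0 := fun h0 => by
      have := congrArg (eval 0) h0
      simp only [map_sub, map_pow, eval_X, map_ofNat, map_zero] at this
      norm_num at this
    exact (mul_eq_zero.1 hprod).resolve_right (mul_ne_zero (hX 0) (hX 1))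
  refine ⟨MvPolynomial.funext fun x => ?_, hB⟩
  obtain ⟨s, hs⟩ := exists_unit_add_inv (x 0)
  obtain ⟨t, ht⟩ := exists_unit_add_inv (x 1)
  have hx : ![x 0, x 1] = x := by
    ext i
    fin_cases i <;> rfl
  have k := key s t
  rw [hs, ht, hx] at k
  simpa [hB] using k

lemma ker_traceHom [IsAlgClosed K] [CharZero K] :
    RingHom.ker (traceHom K) = Ideal.span {cayleyCubic K} := by
  have hle : Ideal.span {cayleyCubic K} ≤ RingHom.ker (traceHom K) := by
    rw [Ideal.span_singleton_le_iff_mem]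
    exact traceHom_cayleyCubic
  refine le_antisymm (fun F hF => ?_) hle
  obtain ⟨A, B, hAB⟩ := exists_sub_mem_span_cayleyCubic F
  have h : traceHom K _ = 0 := (Submodule.sub_mem_iff_right _ hF).1 (hle hAB)
  obtain ⟨rfl, rfl⟩ := eq_zero_of_traceHom_eq_zero h
  simpa using hAB

lemma range_traceHom [CharZero K]
    {σ : AddMonoidAlgebra K (ℤ × ℤ) →ₐ[K] AddMonoidAlgebra K (ℤ × ℤ)}
    (hσ : ∀ v, σ (single v 1) = single (-v) 1) :
    (traceHom K).range = AlgHom.equalizer σ (AlgHom.id K _) := by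
  refine le_antisymm ?_ fun f hf => ?_
  · have hfix (v : ℤ × ℤ) : σ (symMonomial K v) = symMonomial K v := by
      rw [symMonomial, map_add, hσ, hσ, neg_neg, add_comm]
    rintro _ ⟨F, rfl⟩
    have : σ.comp (traceHom K) = traceHom K := by
      ext1 i
      fin_cases i <;> simp [traceHom, hfix]
    exact DFunLike.congr_fun this F
  · have hf' : σ f = f := hf
    have h := add_apply_mem_of_single_neg hσ symMonomial_mem_range_traceHom f
    rw [hf', ← two_smul K f] at h
    simpa using (traceHom K).range.smul_mem h (2⁻¹ : K)

end

open MvPolynomial AddMonoidAlgebra in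
/-- Let `σ` be the `𝕂`-algebra involution of the Laurent polynomial ring
`𝕂[t₁^{±1}, t₂^{±1}]` (realized as the group algebra of `ℤ²`) with `σ(t₁) = t₁⁻¹`,
`σ(t₂) = t₂⁻¹`, and let `φ : 𝕂[X,Y,Z] → 𝕂[t₁^{±1}, t₂^{±1}]` be the `𝕂`-algebra
homomorphism with `φ(X) = t₁ + t₁⁻¹`, `φ(Y) = t₂ + t₂⁻¹`, `φ(Z) = t₁t₂ + t₁⁻¹t₂⁻¹`.
Then the image of `φ` is the subalgebra of `σ`-invariants, its kernel is the principal
ideal generated by `XYZ - X² - Y² - Z² + 4`, and hence `φ` induces an isomorphism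
`𝕂[X,Y,Z]/(XYZ - X² - Y² - Z² + 4) ≅ 𝕂[t₁^{±1}, t₂^{±1}]^σ`. -/
theorem statement16 (𝕂 : Type*) [Field 𝕂] [IsAlgClosed 𝕂] [CharZero 𝕂]
    (σ : AddMonoidAlgebra 𝕂 (ℤ × ℤ) →ₐ[𝕂] AddMonoidAlgebra 𝕂 (ℤ × ℤ))
    (hσ1 : σ (single ((1, 0) : ℤ × ℤ) (1 : 𝕂)) = single ((-1, 0) : ℤ × ℤ) (1 : 𝕂))
    (hσ2 : σ (single ((0, 1) : ℤ × ℤ) (1 : 𝕂)) = single ((0, -1) : ℤ × ℤ) (1 : 𝕂))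
    (φ : MvPolynomial (Fin 3) 𝕂 →ₐ[𝕂] AddMonoidAlgebra 𝕂 (ℤ × ℤ))
    (hφ : φ = aeval
      ![single ((1, 0) : ℤ × ℤ) (1 : 𝕂) + single ((-1, 0) : ℤ × ℤ) (1 : 𝕂),
        single ((0, 1) : ℤ × ℤ) (1 : 𝕂) + single ((0, -1) : ℤ × ℤ) (1 : 𝕂),
        single ((1, 1) : ℤ × ℤ) (1 : 𝕂) + single ((-1, -1) : ℤ × ℤ) (1 : 𝕂)]) :
    φ.range = AlgHom.equalizer σ (AlgHom.id 𝕂 (AddMonoidAlgebra 𝕂 (ℤ × ℤ))) ∧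
    RingHom.ker φ = Ideal.span {(X 0 : MvPolynomial (Fin 3) 𝕂) * X 1 * X 2
      - X 0 ^ 2 - X 1 ^ 2 - X 2 ^ 2 + 4} ∧
    Nonempty ((MvPolynomial (Fin 3) 𝕂 ⧸ Ideal.span {(X 0 : MvPolynomial (Fin 3) 𝕂) * X 1 * X 2
        - X 0 ^ 2 - X 1 ^ 2 - X 2 ^ 2 + 4})
      ≃ₐ[𝕂] AlgHom.equalizer σ (AlgHom.id 𝕂 (AddMonoidAlgebra 𝕂 (ℤ × ℤ)))) := by
  have hφ' : φ = traceHom 𝕂 := by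
    rw [hφ, traceHom]
    simp [symMonomial]
  subst hφ'
  have hrange := range_traceHom (algHom_single_eq_single_neg hσ1 hσ2)
  have hker := ker_traceHom (K := 𝕂)
  exact ⟨hrange, hker, ⟨(Ideal.quotientEquivAlgOfEq 𝕂 hker.symm).trans
    ((Ideal.quotientKerEquivRange (traceHom 𝕂)).trans (Subalgebra.equivOfEq _ _ hrange))⟩⟩
end

section
/- Let 𝕂 be an algebraically closed field of characteristic zero and let R = 𝕂[T₁, T₂, T₃]/(T₁T₂T₃ − T₁² − T₂² − T₃² + 4). Then every unit of R is a non-zero constant, i.e., R^× is the image of 𝕂^× under the structure map 𝕂 → R. -/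
open Polynomial in
/-- The polynomial Pell equation `P² - D Q² = e` with constant `e` has only solutions with `Q = 0`
when `D` is nonconstant and its leading coefficient is not a square up to squares. -/
theorem Polynomial.eq_zero_of_sq_sub_mul_sq_eq_C {A : Type*} [CommRing A] [IsDomain A]
    {D P Q : A[X]} {e : A} (hdeg : 0 < D.degree)
    (hlead : ∀ p q : A, p ^ 2 = D.leadingCoeff * q ^ 2 → q = 0)
    (h : P ^ 2 - D * Q ^ 2 = C e) : Q = 0 := by
  by_contra hQ
  have hlt : (C e).degree < (D * Q ^ 2).degree := by
    refine degree_C_le.trans_lt ?_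
    rw [degree_mul, degree_eq_natDegree (pow_ne_zero 2 hQ)]
    exact add_pos_of_pos_of_nonneg hdeg (by positivity)
  have hP : P ^ 2 = C e + D * Q ^ 2 := by linear_combination h
  have hl := congrArg leadingCoeff hP
  rw [leadingCoeff_add_of_degree_lt hlt, leadingCoeff_mul, leadingCoeff_pow, leadingCoeff_pow] at hl
  exact hQ (leadingCoeff_eq_zero.mp (hlead _ _ hl))

open Polynomial in
/-- A polynomial with a simple root is not a quotient of two squares. -/
theorem Polynomial.eq_zero_of_sq_eq_mul_sq_of_rootMultiplicity_eq_one {A : Type*} [CommRing A]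
    [IsDomain A] {u p q : A[X]} {a : A} (hu : u.rootMultiplicity a = 1)
    (h : p ^ 2 = u * q ^ 2) : q = 0 := by
  by_contra hq
  have hu0 : u ≠ 0 := by
    rintro rfl
    simp at hu
  have hne : u * q ^ 2 ≠ 0 := mul_ne_zero hu0 (pow_ne_zero 2 hq)
  have hp : p * p ≠ 0 := by rwa [← sq, h]
  have hm := congrArg (rootMultiplicity a) h
  rw [rootMultiplicity_mul hne, hu, sq, sq, rootMultiplicity_mul hp,
    rootMultiplicity_mul (mul_ne_zero hq hq)] at hm
  lia

open Polynomial in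
/-- The quadratic algebra over `K[y][x]` generated by a root `ω` of
`ω² = (4 - x² - y²) + x y ω`. -/
abbrev MarkovQuadraticAlgebra (K : Type*) [CommRing K] : Type _ :=
  QuadraticAlgebra K[X][X] (4 - X ^ 2 - C X ^ 2) (X * C X)

open MvPolynomial in
/-- The third coordinate satisfies a monic quadratic equation over the first two, which embeds the
coordinate ring into the quadratic algebra. -/
theorem exists_injective_algHom_markovQuadraticAlgebra (K : Type*) [CommRing K] :
    ∃ φ : (MvPolynomial (Fin 3) K ⧸ Ideal.span {(X 0 : MvPolynomial (Fin 3) K) * X 1 * X 2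
      - X 0 ^ 2 - X 1 ^ 2 - X 2 ^ 2 + 4}) →ₐ[K] MarkovQuadraticAlgebra K,
      Function.Injective φ := by
  set I := Ideal.span {(X 0 : MvPolynomial (Fin 3) K) * X 1 * X 2
    - X 0 ^ 2 - X 1 ^ 2 - X 2 ^ 2 + 4} with hI
  let x : MarkovQuadraticAlgebra K := ⟨Polynomial.X, 0⟩
  let y : MarkovQuadraticAlgebra K := ⟨Polynomial.C Polynomial.X, 0⟩
  let w : MarkovQuadraticAlgebra K := ⟨0, 1⟩
  have hker : ∀ f ∈ I, aeval ![x, y, w] f = 0 := by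
    have : I ≤ RingHom.ker (aeval (R := K) ![x, y, w]) := by
      rw [hI, Ideal.span_singleton_le_iff_mem, RingHom.mem_ker]
      ext1
      · simp [x, y, w, sq, QuadraticAlgebra.re_ofNat]
        ring
      · simp [x, y, w, sq, QuadraticAlgebra.im_ofNat]
    exact fun f hf => this hf
  let φ := Ideal.Quotient.liftₐ I (aeval ![x, y, w]) hker
  let mk : MvPolynomial (Fin 3) K →+* MvPolynomial (Fin 3) K ⧸ I := Ideal.Quotient.mk I
  have hφ : ∀ f, φ (mk f) = aeval ![x, y, w] f := fun _ => rfl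
  obtain ⟨g, hg0, hg1, hgC⟩ : ∃ g : Polynomial (Polynomial K) →+* MvPolynomial (Fin 3) K ⧸ I,
      g Polynomial.X = mk (X 0) ∧ g (Polynomial.C Polynomial.X) = mk (X 1) ∧
      ∀ c, g (Polynomial.C (Polynomial.C c)) = mk (C c) :=
    ⟨Polynomial.eval₂RingHom (Polynomial.eval₂RingHom (mk.comp C) (mk (X 1))) (mk (X 0)),
      by simp, by simp, by simp⟩
  let : Algebra (Polynomial (Polynomial K)) (MvPolynomial (Fin 3) K ⧸ I) := g.toAlgebra
  have hrel : mk (X 0) * mk (X 1) * mk (X 2) - mk (X 0) ^ 2 - mk (X 1) ^ 2 - mk (X 2) ^ 2 + 4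
      = 0 := by
    simp only [← map_mul, ← map_pow, ← map_sub, ← map_ofNat mk 4, ← map_add]
    exact Ideal.Quotient.eq_zero_iff_mem.mpr (Ideal.mem_span_singleton_self _)
  let ψ : MarkovQuadraticAlgebra K →ₐ[Polynomial (Polynomial K)] MvPolynomial (Fin 3) K ⧸ I :=
    QuadraticAlgebra.lift ⟨mk (X 2), by
      simp only [Algebra.smul_def, RingHom.algebraMap_toAlgebra, map_sub, map_mul, map_pow,
        map_ofNat, hg0, hg1]
      linear_combination -hrel⟩
  have hψ : ∀ z, ψ z = g z.re + g z.im * mk (X 2) := fun z => by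
    simp [ψ, Algebra.smul_def, RingHom.algebraMap_toAlgebra]
  have hcomp : ψ.toRingHom.comp φ.toRingHom = RingHom.id _ := by
    refine Ideal.Quotient.ringHom_ext (MvPolynomial.ringHom_ext (fun c => ?_) (fun i => ?_))
    · change ψ (φ (mk (C c))) = mk (C c)
      rw [hφ, hψ, ← hgC, ← algebraMap_eq, AlgHom.commutes]
      change g (Polynomial.C (Polynomial.C c)) + g 0 * mk (X 2) = _
      simp
    · change ψ (φ (mk (X i))) = mk (X i)
      rw [hφ, hψ, aeval_X]
      fin_cases i <;> simp [x, y, w, hg0, hg1]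
  exact ⟨φ, Function.LeftInverse.injective (g := ψ) (fun z => RingHom.congr_fun hcomp z)⟩

open Polynomial in
/-- Units of the quadratic algebra are constants: their norm is a constant, and completing the
square turns the norm into a polynomial Pell equation. -/
theorem MarkovQuadraticAlgebra.exists_algebraMap_eq_of_isUnit {K : Type*} [Field K]
    [CharZero K] {z : MarkovQuadraticAlgebra K} (hz : IsUnit z) :
    ∃ c : K, c ≠ 0 ∧ algebraMap K (MarkovQuadraticAlgebra K) c = z := by
  have hN := QuadraticAlgebra.isUnit_iff_norm_isUnit.mp hz
  obtain ⟨d, hd, hdN⟩ := isUnit_iff.mp hN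
  have hlc : ((C (X ^ 2 - 4) * (X ^ 2 - C 4) : K[X][X])).leadingCoeff = X ^ 2 - 4 := by
    rw [leadingCoeff_mul, leadingCoeff_C, leadingCoeff_X_pow_sub_C (by simp), mul_one]
  have hfac : (X ^ 2 - 4 : K[X]) = (X - C 2) * (X - C (-2)) := by
    simp only [map_neg, map_ofNat]
    ring
  have hne : (X ^ 2 - 4 : K[X]) ≠ 0 := by
    rw [hfac]
    exact mul_ne_zero (X_sub_C_ne_zero _) (X_sub_C_ne_zero _)
  have hmult : (X ^ 2 - 4 : K[X]).rootMultiplicity 2 = 1 := by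
    have h4 : ¬ IsRoot (X - C (-2) : K[X]) 2 := by
      simp only [IsRoot.def, eval_sub, eval_X, eval_C]
      norm_num
    rw [hfac, rootMultiplicity_mul (hfac ▸ hne), rootMultiplicity_X_sub_C_self,
      rootMultiplicity_eq_zero h4]
  have him : z.im = 0 := by
    refine eq_zero_of_sq_sub_mul_sq_eq_C (D := C (X ^ 2 - 4) * (X ^ 2 - C 4))
      (P := 2 * z.re + X * C X * z.im) (e := 4 * d) ?_ ?_ ?_
    · rw [degree_mul, degree_C hne, degree_X_pow_sub_C (by simp)]
      norm_num
    · intro p q h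
      rw [hlc] at h
      exact eq_zero_of_sq_eq_mul_sq_of_rootMultiplicity_eq_one hmult h
    · rw [QuadraticAlgebra.norm_def] at hdN
      simp only [map_mul, map_sub, map_pow, map_ofNat]
      linear_combination -4 * hdN
  have hre : IsUnit z.re := by
    rw [QuadraticAlgebra.norm_def, him] at hN
    exact isUnit_of_mul_isUnit_left (y := z.re) (by
       simpa only [mul_zero, add_zero, sub_zero] using hN)
  obtain ⟨a, ha, haz⟩ := isUnit_iff.mp hre
  obtain ⟨c, hc, hca⟩ := isUnit_iff.mp ha
  exact ⟨c, hc.ne_zero, QuadraticAlgebra.ext (by rw [← haz, ← hca]; rfl) him.symm⟩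


open MvPolynomial in
/-- The units of the coordinate ring `𝕂[T₁,T₂,T₃]/(T₁T₂T₃ - T₁² - T₂² - T₃² + 4)` of
the affine surface `V(T₁T₂T₃ - T₁² - T₂² - T₃² + 4) ⊆ 𝕂³` are exactly the non-zero
constants. -/
theorem statement17 (𝕂 : Type*) [Field 𝕂] [IsAlgClosed 𝕂] [CharZero 𝕂]
    (x : MvPolynomial (Fin 3) 𝕂 ⧸
      Ideal.span {(X 0 : MvPolynomial (Fin 3) 𝕂) * X 1 * X 2
        - X 0 ^ 2 - X 1 ^ 2 - X 2 ^ 2 + 4}) :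
    IsUnit x ↔ ∃ c : 𝕂, c ≠ 0 ∧
      algebraMap 𝕂 (MvPolynomial (Fin 3) 𝕂 ⧸
        Ideal.span {(X 0 : MvPolynomial (Fin 3) 𝕂) * X 1 * X 2
          - X 0 ^ 2 - X 1 ^ 2 - X 2 ^ 2 + 4}) c = x := by
  constructor
  · intro hx
    obtain ⟨φ, hφ⟩ := exists_injective_algHom_markovQuadraticAlgebra 𝕂
    obtain ⟨c, hc, hcx⟩ := MarkovQuadraticAlgebra.exists_algebraMap_eq_of_isUnit (hx.map φ)
    exact ⟨c, hc, hφ (by rw [AlgHom.commutes, hcx])⟩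
  · rintro ⟨c, hc, rfl⟩
    exact (IsUnit.mk0 c hc).map (algebraMap 𝕂 _)
end
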